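/- arXiv:1110.1072 — 5 statements merged into one kernel-verified Lean document; each statement's English description precedes it below -/
import Mathlib

section
/- Let g be a finite-dimensional semisimple Lie algebra over K, V a finite-dimensional vector space regarded as an abelian Lie algebra, and l = g × V the direct product Lie algebra. Then for every antisymmetric 1-cocycle δ : l → l ⊗ l there exist an antisymmetric element r ∈ l ⊗ l and a linear map φ : V → V ⊗ V such that δ(w) = w · r + (ι ⊗ ι)(φ(π_V(w))) for all w ∈ l, where ι : V → l is the inclusion and π_V : l → V the projection. -/
open TensorProduct

section PaperDefs

variable (K : Type*) [CommRing K] (L : Type*) [LieRing L] [LieAlgebra K L]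

/-- The Lie bracket of `L`, as a bilinear map. -/
def bracketBilin : L →ₗ[K] L →ₗ[K] L :=
  LinearMap.mk₂ K (fun x y => ⁅x, y⁆) add_lie smul_lie lie_add lie_smul

/-- The linear map `β : L ⊗ L → L` induced by the Lie bracket, `β (a ⊗ b) = ⁅a, b⁆`. -/
noncomputable def bracketMap : L ⊗[K] L →ₗ[K] L :=
  TensorProduct.lift (bracketBilin K L)

/-- The cyclic permutation `σ : a ⊗ b ⊗ c ↦ c ⊗ a ⊗ b` on the triple tensor product. -/
noncomputable def cyc : L ⊗[K] (L ⊗[K] L) ≃ₗ[K] L ⊗[K] (L ⊗[K] L) :=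
  (TensorProduct.assoc K L L L).symm.trans (TensorProduct.comm K (L ⊗[K] L) L)

variable {K L}

/-- `δ` is a 1-cocycle with values in `L ⊗ L`, where `L ⊗ L` carries the module structure
`⁅x, a ⊗ b⁆ = ⁅x, a⁆ ⊗ b + a ⊗ ⁅x, b⁆`. -/
def IsCocycle (δ : L →ₗ[K] L ⊗[K] L) : Prop :=
  ∀ x y : L, δ ⁅x, y⁆ = ⁅x, δ y⁆ - ⁅y, δ x⁆

/-- `δ : L → L ⊗ L` is antisymmetric: `swap ∘ δ = -δ`. -/
def IsAntisym (δ : L →ₗ[K] L ⊗[K] L) : Prop :=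
  ∀ x : L, TensorProduct.comm K L L (δ x) = - δ x

/-- `δ` satisfies the co-Jacobi identity: `ξ + σ ξ + σ² ξ = 0` where
`ξ = (δ ⊗ id) (δ x)` and `σ` is the cyclic permutation. -/
noncomputable def CoJacobi (δ : L →ₗ[K] L ⊗[K] L) : Prop :=
  ∀ x : L,
    (TensorProduct.assoc K L L L) ((TensorProduct.map δ LinearMap.id) (δ x))
      + (cyc K L) ((TensorProduct.assoc K L L L) ((TensorProduct.map δ LinearMap.id) (δ x)))
      + (cyc K L) ((cyc K L)
          ((TensorProduct.assoc K L L L) ((TensorProduct.map δ LinearMap.id) (δ x)))) = 0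

/-- A Lie bialgebra structure on the Lie algebra `L` is an antisymmetric 1-cocycle
satisfying the co-Jacobi identity. -/
noncomputable def IsLieBialgebra (δ : L →ₗ[K] L ⊗[K] L) : Prop :=
  IsAntisym δ ∧ IsCocycle δ ∧ CoJacobi δ

/-- `D : L → L` is a derivation of the Lie bracket. -/
def IsDerivation (D : L →ₗ[K] L) : Prop :=
  ∀ x y : L, D ⁅x, y⁆ = ⁅D x, y⁆ + ⁅x, D y⁆

/-- `D : L → L` is a coderivation of `δ`: `(D ⊗ id + id ⊗ D) ∘ δ = δ ∘ D`. -/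
def IsCoderivation (δ : L →ₗ[K] L ⊗[K] L) (D : L →ₗ[K] L) : Prop :=
  ∀ x : L,
    (TensorProduct.map D (LinearMap.id : L →ₗ[K] L)
      + TensorProduct.map (LinearMap.id : L →ₗ[K] L) D) (δ x) = δ (D x)

/-- A biderivation of `(L, δ)` is a derivation of the bracket which is a coderivation of `δ`. -/
def IsBiderivation (δ : L →ₗ[K] L ⊗[K] L) (D : L →ₗ[K] L) : Prop :=
  IsDerivation D ∧ IsCoderivation δ D

/-- The linear map `x ↦ ⁅x, r⁆ = x · r`, for a fixed `r ∈ L ⊗ L`. -/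
noncomputable def adjMap (r : L ⊗[K] L) : L →ₗ[K] L ⊗[K] L where
  toFun x := ⁅x, r⁆
  map_add' x y := add_lie x y r
  map_smul' t x := smul_lie t x r

end PaperDefs

section ProdLie

variable (L M : Type*) [LieRing L] [LieRing M]

/-- The direct product of two Lie rings. -/
instance prodLieRing : LieRing (L × M) where
  bracket x y := (⁅x.1, y.1⁆, ⁅x.2, y.2⁆)
  add_lie x y z := by ext <;> exact add_lie ..
  lie_add x y z := by ext <;> exact lie_add ..
  lie_self x := by ext <;> exact lie_self _
  leibniz_lie x y z := by ext <;> exact leibniz_lie ..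

/-- The direct product of two Lie algebras. -/
instance prodLieAlgebra (K : Type*) [CommRing K] [LieAlgebra K L] [LieAlgebra K M] :
    LieAlgebra K (L × M) where
  lie_smul t x y := by ext <;> exact lie_smul ..

end ProdLie

/-- Every ideal of a semisimple Lie algebra is perfect. -/
lemma LieAlgebra.IsSemisimple.lie_ideal_self {K L : Type*} [Field K] [LieRing L] [LieAlgebra K L]
    [LieAlgebra.IsSemisimple K L] (I : LieIdeal K L) : ⁅I, I⁆ = I := by
  refine le_antisymm (LieSubmodule.lie_le_left I I) ?_
  have hab : IsLieAbelian (I ⊓ ⁅I, I⁆ᶜ : LieIdeal K L) := by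
    rw [LieSubmodule.lie_abelian_iff_lie_self_eq_bot, eq_bot_iff, ← inf_compl_eq_bot (a := ⁅I, I⁆)]
    exact le_inf (LieSubmodule.mono_lie inf_le_left inf_le_left)
      ((LieSubmodule.lie_le_left _ _).trans inf_le_right)
  rw [← disjoint_compl_right_iff, disjoint_iff]
  exact LieAlgebra.HasTrivialRadical.eq_bot_of_isSolvable _

/-- A perfect ideal acting nilpotently acts trivially. -/
lemma LieIdeal.lie_top_eq_bot_of_isNilpotent {K L M : Type*} [CommRing K] [LieRing L]
    [LieAlgebra K L] [AddCommGroup M] [Module K M] [LieRingModule L M] [LieModule K L M]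
    {I : LieIdeal K L} (hI : ⁅I, I⁆ = I) (hnil : LieModule.IsNilpotent I M) :
    ⁅I, (⊤ : LieSubmodule K L M)⁆ = ⊥ := by
  have hle (N : LieSubmodule K L M) : ⁅I, N⁆ ≤ ⁅I, ⁅I, N⁆⁆ := by
    refine (LieSubmodule.lie_le_iff _ _ _).mpr fun x hx n hn ↦ ?_
    rw [← hI, ← LieSubmodule.mem_toSubmodule, LieSubmodule.lieIdeal_oper_eq_linear_span'] at hx
    induction hx using Submodule.span_induction with
    | mem x hx =>
      obtain ⟨y, hy, z, hz, rfl⟩ := hx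
      rw [lie_lie]
      exact sub_mem (LieSubmodule.lie_mem_lie hy (LieSubmodule.lie_mem_lie hz hn))
        (LieSubmodule.lie_mem_lie hz (LieSubmodule.lie_mem_lie hy hn))
    | zero => simp
    | add x y _ _ hx hy => rw [add_lie]; exact add_mem hx hy
    | smul t x _ hx => rw [smul_lie]; exact SMulMemClass.smul_mem t hx
  have hlcs (k : ℕ) : ⁅I, (⊤ : LieSubmodule K L M)⁆ ≤ I.lcs M k := by
    induction k with
    | zero => simp
    | succ k ih =>
      rw [LieIdeal.lcs_succ]
      exact (hle _).trans (LieSubmodule.mono_lie_right _ ih)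
  obtain ⟨k, hk⟩ := (LieModule.isNilpotent_iff K I M).mp hnil
  rw [eq_bot_iff]
  refine (hlcs k).trans ?_
  rw [← LieSubmodule.toSubmodule_le_toSubmodule, LieIdeal.coe_lcs_eq, hk]
  simp

/-- The kernel of the trace form of a representation of a semisimple Lie algebra acts trivially. -/
lemma LieModule.lie_eq_zero_of_mem_ker_traceForm {K L M : Type*} [Field K] [CharZero K] [LieRing L]
    [LieAlgebra K L] [LieAlgebra.IsSemisimple K L] [AddCommGroup M]
    [Module K M] [LieRingModule L M] [LieModule K L M] [FiniteDimensional K M] {I : LieIdeal K L}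
    (hI : ∀ x ∈ I, LieModule.traceForm K L M x = 0) {x : L} (hx : x ∈ I) (m : M) :
    ⁅x, m⁆ = 0 := by
  have hself := LieAlgebra.IsSemisimple.lie_ideal_self I
  have htf : LieModule.traceForm K I M = 0 := by
    ext ⟨x, hx⟩ ⟨y, hy⟩
    exact LinearMap.congr_fun (hI x hx) y
  have hder := LieModule.isNilpotent_derivedSeries_of_traceForm_eq_zero htf
  have hnil : LieModule.IsNilpotent I M := by
    rw [LieModule.isNilpotent_iff_forall' (R := K)] at hder ⊢
    intro y
    refine hder ⟨y, ?_⟩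
    rw [LieIdeal.derivedSeries_eq_derivedSeriesOfIdeal_comap, LieIdeal.mem_comap,
      LieAlgebra.derivedSeriesOfIdeal_succ, LieAlgebra.derivedSeriesOfIdeal_zero, hself]
    exact y.2
  have := LieIdeal.lie_top_eq_bot_of_isNilpotent (M := M) hself hnil
  exact (LieSubmodule.lie_eq_bot_iff _ _).mp this x hx m trivial

/-- A linear map vanishing on brackets of elements of an ideal vanishes on the ideal. -/
lemma LieAlgebra.IsSemisimple.map_eq_zero_of_mem {K L M : Type*} [Field K] [LieRing L]
    [LieAlgebra K L] [LieAlgebra.IsSemisimple K L] [AddCommGroup M] [Module K M]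
    {I : LieIdeal K L} (f : L →ₗ[K] M) (hf : ∀ x ∈ I, ∀ y ∈ I, f ⁅x, y⁆ = 0) {x : L}
    (hx : x ∈ I) : f x = 0 := by
  rw [← LieAlgebra.IsSemisimple.lie_ideal_self I, ← LieSubmodule.mem_toSubmodule,
    LieSubmodule.lieIdeal_oper_eq_linear_span'] at hx
  refine (Submodule.span_le (p := LinearMap.ker f)).mpr ?_ hx
  rintro _ ⟨y, hy, z, hz, rfl⟩
  exact hf y hy z hz

/-- The radical of the trace form, as an ideal. -/
noncomputable def LieModule.traceFormKer (K L M : Type*) [CommRing K] [LieRing L]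
    [LieAlgebra K L] [AddCommGroup M] [Module K M] [LieRingModule L M] [LieModule K L M] :
    LieIdeal K L where
  __ := LinearMap.ker (LieModule.traceForm K L M)
  lie_mem {x y} hy := by
    have hy' : LieModule.traceForm K L M y = 0 := hy
    change LieModule.traceForm K L M ⁅x, y⁆ = 0
    ext z
    rw [LieModule.traceForm_apply_lie_apply', hy']
    simp

/-- A symmetric bilinear form admits families that are dual bases modulo its kernel. -/
lemma LinearMap.IsSymm.exists_dual_families {K L : Type*} [Field K] [AddCommGroup L] [Module K L]
    [FiniteDimensional K L] {B : LinearMap.BilinForm K L} (hB : LinearMap.IsSymm B) :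
    ∃ (n : ℕ) (e e' : Fin n → L), (B ≠ 0 → n ≠ 0) ∧ (∀ i, B (e i) (e' i) = 1) ∧
      (∀ x, B (x - ∑ i, B x (e' i) • e i) = 0) ∧ ∀ x, B (x - ∑ i, B x (e i) • e' i) = 0 := by
  obtain ⟨W, hW⟩ := Submodule.exists_isCompl (LinearMap.ker B)
  have hnd := hB.nondegenerate_restrict_of_isCompl_ker hW.symm
  have hsymm : LinearMap.BilinForm.IsSymm (B.domRestrict₁₂ W W) := ⟨fun x y ↦ hB.eq x y⟩
  let b := Module.finBasis K W
  let b' := LinearMap.BilinForm.dualBasis (B.domRestrict₁₂ W W) hnd b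
  have hker (x : L) : ∃ w : W, B (x - w) = 0 := by
    obtain ⟨k, hk, w, hw, rfl⟩ := Submodule.mem_sup.mp (hW.sup_eq_top ▸ Submodule.mem_top (x := x))
    exact ⟨⟨w, hw⟩, by simpa using hk⟩
  have key (c c' : Module.Basis (Fin (Module.finrank K W)) K W)
      (hcc : ∀ w i, c.repr w i = B w (c' i)) (x : L) :
      B (x - ∑ i, B x (c' i) • (c i : L)) = 0 := by
    obtain ⟨w, hw⟩ := hker x
    have hBx (y : L) : B x y = B w y := by
      simpa [sub_eq_zero] using LinearMap.congr_fun hw y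
    have hsum : ∑ i, B x (c' i) • (c i : L) = w := by
      conv_rhs => rw [← c.sum_repr w]
      simp [hcc, hBx]
    rw [hsum, hw]
  refine ⟨Module.finrank K W, fun i ↦ b i, fun i ↦ b' i, fun h0 hn ↦ h0 ?_, fun i ↦ ?_,
    key b b' fun w i ↦ ?_, key b' b fun w i ↦ ?_⟩
  · have hWbot : W = ⊥ := Submodule.finrank_eq_zero.mp hn
    have := hW.sup_eq_top
    rwa [hWbot, sup_bot_eq, LinearMap.ker_eq_top] at this
  · have := LinearMap.BilinForm.apply_dualBasis_right hnd hsymm b i i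
    rwa [if_pos rfl] at this
  · have := LinearMap.BilinForm.dualBasis_repr_apply hnd b' w i
    rwa [LinearMap.BilinForm.dualBasis_dualBasis hnd hsymm] at this
  · exact LinearMap.BilinForm.dualBasis_repr_apply hnd b w i

/-- Invariance of the Casimir tensor, paired with a bilinear map that descends modulo the kernel
of the trace form. -/
lemma LieModule.sum_lie_dual_families_eq_zero {K L M N : Type*} [Field K] [LieRing L]
    [LieAlgebra K L] [AddCommGroup M] [Module K M] [LieRingModule L M] [LieModule K L M]
    [AddCommGroup N] [Module K N] {ι : Type*} [Fintype ι] {e e' : ι → L}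
    (he : ∀ x, traceForm K L M (x - ∑ i, traceForm K L M x (e' i) • e i) = 0)
    (he' : ∀ x, traceForm K L M (x - ∑ i, traceForm K L M x (e i) • e' i) = 0)
    (Φ : L →ₗ[K] L →ₗ[K] N) (hl : ∀ x, traceForm K L M x = 0 → Φ x = 0)
    (hr : ∀ x y, traceForm K L M y = 0 → Φ x y = 0) (x : L) :
    ∑ i, (Φ ⁅x, e i⁆ (e' i) + Φ (e i) ⁅x, e' i⁆) = 0 := by
  have h1 (i : ι) : Φ ⁅x, e i⁆ (e' i) =
      ∑ j, traceForm K L M ⁅x, e i⁆ (e' j) • Φ (e j) (e' i) := by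
    have := LinearMap.congr_fun (hl _ (he ⁅x, e i⁆)) (e' i)
    simpa [sub_eq_zero] using this
  have h2 (i : ι) : Φ (e i) ⁅x, e' i⁆ =
      ∑ j, traceForm K L M ⁅x, e' i⁆ (e j) • Φ (e i) (e' j) := by
    have := hr (e i) _ (he' ⁅x, e' i⁆)
    simpa [sub_eq_zero] using this
  rw [Finset.sum_add_distrib, Finset.sum_congr rfl fun i _ ↦ h1 i,
    Finset.sum_congr rfl fun i _ ↦ h2 i, Finset.sum_comm, ← Finset.sum_add_distrib]
  refine Finset.sum_eq_zero fun i _ ↦ ?_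
  rw [← Finset.sum_add_distrib]
  refine Finset.sum_eq_zero fun j _ ↦ ?_
  rw [traceForm_apply_lie_apply', traceForm_comm, neg_smul, neg_add_cancel]

/-- A nonzero trace form yields an equivariant endomorphism that is not nilpotent and through which
every cocycle becomes a coboundary. -/
lemma LieModule.exists_casimir {K L M : Type*} [Field K] [CharZero K] [LieRing L]
    [LieAlgebra K L] [LieAlgebra.IsSemisimple K L] [FiniteDimensional K L] [AddCommGroup M]
    [Module K M] [LieRingModule L M] [LieModule K L M] [FiniteDimensional K M]
    (hne : traceForm K L M ≠ 0) (f : L →ₗ[K] M) (hf : ∀ x y, f ⁅x, y⁆ = ⁅x, f y⁆ - ⁅y, f x⁆) :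
    ∃ (C : Module.End K M) (m : M), ¬ _root_.IsNilpotent C ∧ (∀ (x : L) n, C ⁅x, n⁆ = ⁅x, C n⁆) ∧
      ∀ x, C (f x) = ⁅x, m⁆ := by
  obtain ⟨n, e, e', hn, hee, he, he'⟩ := (traceForm_isSymm K L M).exists_dual_families
  have hact {x : L} (hx : traceForm K L M x = 0) : toEnd K L M x = 0 := by
    ext m
    exact lie_eq_zero_of_mem_ker_traceForm (I := traceFormKer K L M) (fun _ h ↦ h) hx m
  have hfker {x : L} (hx : traceForm K L M x = 0) : f x = 0 := by
    refine LieAlgebra.IsSemisimple.map_eq_zero_of_mem (I := traceFormKer K L M) f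
      (fun y hy z hz ↦ ?_) hx
    have h1 := LinearMap.congr_fun (hact hy) (f z)
    have h2 := LinearMap.congr_fun (hact hz) (f y)
    rw [toEnd_apply_apply, LinearMap.zero_apply] at h1 h2
    rw [hf, h1, h2, sub_zero]
  have hρ := sum_lie_dual_families_eq_zero he he'
    ((LinearMap.mul K (Module.End K M)).compl₁₂ (toEnd K L M : L →ₗ[K] _) (toEnd K L M : L →ₗ[K] _))
    (fun x hx ↦ by ext; simp [hact hx]) (fun x y hy ↦ by simp [hact hy])
  have hfe := sum_lie_dual_families_eq_zero he he'
    ((toEnd K L M : L →ₗ[K] Module.End K M).compl₂ f)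
    (fun x hx ↦ by ext; simp [hact hx]) (fun x y hy ↦ by simp [hfker hy])
  refine ⟨∑ i, toEnd K L M (e i) * toEnd K L M (e' i), ∑ i, ⁅e i, f (e' i)⁆, fun hC ↦ ?_,
    fun x m ↦ ?_, fun x ↦ ?_⟩
  · have htr := (LinearMap.isNilpotent_trace_of_isNilpotent hC).eq_zero
    have hone (i : Fin n) : LinearMap.trace K M (toEnd K L M (e i) * toEnd K L M (e' i)) = 1 :=
      hee i
    rw [map_sum, Finset.sum_congr rfl fun i _ ↦ hone i] at htr
    exact hn hne (by simpa using htr)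
  · have := LinearMap.congr_fun (hρ x) m
    simp only [LinearMap.compl₁₂_apply, LinearMap.mul_apply', LinearMap.sum_apply,
      LinearMap.add_apply, Module.End.mul_apply, LieHom.coe_toLinearMap, toEnd_apply_apply,
      LinearMap.zero_apply] at this ⊢
    rw [lie_sum, ← sub_eq_zero, ← neg_eq_zero, ← this, ← Finset.sum_sub_distrib,
      ← Finset.sum_neg_distrib]
    refine Finset.sum_congr rfl fun i _ ↦ ?_
    simp only [lie_lie, lie_sub]
    abel
  · have := hfe x
    simp only [LinearMap.compl₂_apply, LieHom.coe_toLinearMap, toEnd_apply_apply] at this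
    simp only [LinearMap.sum_apply, Module.End.mul_apply, toEnd_apply_apply]
    rw [lie_sum, ← sub_eq_zero, ← neg_eq_zero, ← this, ← Finset.sum_sub_distrib,
      ← Finset.sum_neg_distrib]
    refine Finset.sum_congr rfl fun i _ ↦ ?_
    rw [hf]
    simp only [lie_lie, lie_sub]
    abel

/-- **Whitehead's first lemma**: every 1-cocycle of a semisimple Lie algebra with values in a
finite-dimensional module is a coboundary. -/
theorem LieModule.exists_lie_eq_of_cocycle {K L M : Type*} [Field K] [CharZero K] [LieRing L]
    [LieAlgebra K L] [LieAlgebra.IsSemisimple K L] [FiniteDimensional K L] [AddCommGroup M]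
    [Module K M] [LieRingModule L M] [LieModule K L M] [FiniteDimensional K M]
    (f : L →ₗ[K] M) (hf : ∀ x y, f ⁅x, y⁆ = ⁅x, f y⁆ - ⁅y, f x⁆) :
    ∃ m : M, ∀ x, f x = ⁅x, m⁆ := by
  induction hd : Module.finrank K M using Nat.strong_induction_on generalizing M with
  | _ d ih =>
  by_cases htf : traceForm K L M = 0
  · have hact (x : L) (m : M) : ⁅x, m⁆ = 0 :=
      lie_eq_zero_of_mem_ker_traceForm (I := (⊤ : LieIdeal K L))
        (fun x _ ↦ by rw [htf, LinearMap.zero_apply]) (LieSubmodule.mem_top x) m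
    refine ⟨0, fun x ↦ ?_⟩
    rw [lie_zero]
    exact LieAlgebra.IsSemisimple.map_eq_zero_of_mem (I := (⊤ : LieIdeal K L)) f
      (fun y _ z _ ↦ by rw [hf, hact, hact, sub_zero]) (LieSubmodule.mem_top x)
  obtain ⟨C, m, hnil, hC, hCf⟩ := exists_casimir htf f hf
  have hCpow (k : ℕ) (x : L) (n : M) : (C ^ k) ⁅x, n⁆ = ⁅x, (C ^ k) n⁆ := by
    induction k with
    | zero => simp
    | succ k ih => rw [pow_succ', Module.End.mul_apply, ih, hC, Module.End.mul_apply]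
  obtain ⟨k, hk⟩ := Filter.eventually_atTop.mp C.eventually_iInf_range_pow_eq
  obtain ⟨m', hm'⟩ : ∃ m', (C ^ (k + 1)) m' = (C ^ k) m := by
    have : (C ^ k) m ∈ LinearMap.range (C ^ (k + 1)) := by
      rw [← hk (k + 1) k.le_succ, hk k le_rfl]
      exact ⟨m, rfl⟩
    exact this
  let N : LieSubmodule K L M :=
    { LinearMap.ker (C ^ (k + 1)) with
      lie_mem {x n} hn := by
        have hn' : (C ^ (k + 1)) n = 0 := hn
        change (C ^ (k + 1)) ⁅x, n⁆ = 0
        rw [hCpow, hn', lie_zero] }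
  have hN (x : L) : f x - ⁅x, m'⁆ ∈ N := by
    change (C ^ (k + 1)) (f x - ⁅x, m'⁆) = 0
    rw [map_sub, hCpow, hm', pow_succ, Module.End.mul_apply, hCf, hCpow, sub_self]
  have hlt : Module.finrank K N < d := by
    rw [← hd]
    refine Submodule.finrank_lt fun htop ↦ hnil ⟨k + 1, ?_⟩
    exact LinearMap.ker_eq_top.mp htop
  let f' : L →ₗ[K] N :=
    { toFun x := ⟨f x - ⁅x, m'⁆, hN x⟩
      map_add' x y := by
        ext
        simp only [map_add, add_lie, LieSubmodule.coe_add]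
        abel
      map_smul' t x := by
        ext
        simp only [map_smul, smul_lie, LieSubmodule.coe_smul, smul_sub, RingHom.id_apply] }
  have hf' (x : L) : (f' x : M) = f x - ⁅x, m'⁆ := rfl
  obtain ⟨n, hn⟩ := ih _ hlt f' (fun x y ↦ by
    ext
    simp only [hf', hf, lie_lie, LieSubmodule.coe_sub, LieSubmodule.coe_bracket, lie_sub]
    abel) rfl
  refine ⟨m' + n, fun x ↦ ?_⟩
  have := hf' x
  rw [hn, LieSubmodule.coe_bracket] at this
  rw [lie_add, this, add_sub_cancel]

/-- Whitehead's first lemma for a module restricted along a homomorphism from a semisimple Lie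
algebra. -/
lemma LieHom.exists_lie_eq_of_cocycle {K L L' M : Type*} [Field K] [CharZero K] [LieRing L]
    [LieAlgebra K L] [LieAlgebra.IsSemisimple K L] [FiniteDimensional K L] [LieRing L']
    [LieAlgebra K L'] [AddCommGroup M] [Module K M] [LieRingModule L' M] [LieModule K L' M]
    [FiniteDimensional K M] (ι : L →ₗ⁅K⁆ L') (f : L →ₗ[K] M)
    (hf : ∀ x y, f ⁅x, y⁆ = ⁅ι x, f y⁆ - ⁅ι y, f x⁆) :
    ∃ m : M, ∀ x, f x = ⁅ι x, m⁆ :=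
  letI := LieRingModule.compLieHom M ι
  haveI := LieModule.compLieHom (R := K) M ι
  LieModule.exists_lie_eq_of_cocycle f hf

/-- Contraction of the second tensor factor with a functional. -/
noncomputable def contractSnd (K A B : Type*) [CommRing K] [AddCommGroup A] [Module K A]
    [AddCommGroup B] [Module K B] : (B →ₗ[K] K) →ₗ[K] A ⊗[K] B →ₗ[K] A :=
  LinearMap.compRight K (TensorProduct.rid K A).toLinearMap ∘ₗ LinearMap.lTensorHom A

lemma contractSnd_tmul {K A B : Type*} [CommRing K] [AddCommGroup A] [Module K A]
    [AddCommGroup B] [Module K B] (ψ : B →ₗ[K] K) (a : A) (b : B) :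
    contractSnd K A B ψ (a ⊗ₜ[K] b) = ψ b • a := by
  simp [contractSnd]

lemma eq_zero_of_contractSnd {K A B : Type*} [Field K] [AddCommGroup A] [Module K A]
    [AddCommGroup B] [Module K B] {t : A ⊗[K] B}
    (h : ∀ ψ : B →ₗ[K] K, contractSnd K A B ψ t = 0) : t = 0 := by
  classical
  let b := Module.Basis.ofVectorSpace K B
  apply (TensorProduct.equivFinsuppOfBasisRight (M := A) b).injective
  ext i
  rw [TensorProduct.equivFinsuppOfBasisRight_apply, map_zero]
  exact h (b.coord i)

lemma contractSnd_rTensor {K A A' B : Type*} [CommRing K] [AddCommGroup A] [Module K A]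
    [AddCommGroup A'] [Module K A'] [AddCommGroup B] [Module K B] (ψ : B →ₗ[K] K)
    (p : A →ₗ[K] A') (t : A ⊗[K] B) :
    contractSnd K A' B ψ (p.rTensor B t) = p (contractSnd K A B ψ t) := by
  induction t with
  | zero => simp
  | add s t hs ht => simp [hs, ht]
  | tmul a b => simp [contractSnd_tmul]

lemma contractSnd_lie {K A B L : Type*} [CommRing K] [LieRing L] [LieAlgebra K L]
    [AddCommGroup A] [Module K A] [LieRingModule L A] [LieModule K L A]
    [AddCommGroup B] [Module K B] [LieRingModule L B] [LieModule K L B] (ψ : B →ₗ[K] K) (x : L)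
    (t : A ⊗[K] B) :
    contractSnd K A B ψ ⁅x, t⁆ =
      ⁅x, contractSnd K A B ψ t⁆ + contractSnd K A B (ψ ∘ₗ LieModule.toEnd K L B x) t := by
  induction t with
  | zero => simp
  | add s t hs ht =>
    rw [lie_add, map_add, map_add, map_add, hs, ht, lie_add]
    abel
  | tmul a b => simp [contractSnd_tmul]

lemma apply_contractSnd_comm {K A B : Type*} [CommRing K] [AddCommGroup A] [Module K A]
    [AddCommGroup B] [Module K B] (ψ : A →ₗ[K] K) (χ : B →ₗ[K] K) (t : A ⊗[K] B) :
    χ (contractSnd K B A ψ (TensorProduct.comm K A B t)) = ψ (contractSnd K A B χ t) := by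
  induction t with
  | zero => simp
  | add s t hs ht => simp [hs, ht]
  | tmul a b => simp [contractSnd_tmul, mul_comm]

/-- An equivariant endomorphism that is skew with respect to the Killing form of a semisimple Lie
algebra vanishes. -/
lemma LieAlgebra.IsKilling.eq_zero_of_equivariant_of_skew {K L : Type*} [Field K] [CharZero K]
    [LieRing L] [LieAlgebra K L] [FiniteDimensional K L] [LieAlgebra.IsSemisimple K L]
    {T : L →ₗ[K] L} (hT : ∀ x y : L, T ⁅x, y⁆ = ⁅x, T y⁆)
    (hskew : ∀ x y, killingForm K L (T x) y = - killingForm K L x (T y)) : T = 0 := by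
  have hT' (x y : L) : T ⁅x, y⁆ = ⁅T x, y⁆ := by
    rw [← lie_skew, map_neg, hT, lie_skew]
  have hbr (x y : L) : T ⁅x, y⁆ = 0 := by
    refine (LieAlgebra.IsKilling.killingForm_nondegenerate K L).1 _ fun z ↦ ?_
    have h1 : killingForm K L (T ⁅x, y⁆) z = killingForm K L x (T ⁅y, z⁆) := by
      rw [hT, LieModule.traceForm_apply_lie_apply, hT']
    have h2 : killingForm K L (T ⁅x, y⁆) z = killingForm K L (T x) ⁅y, z⁆ := by
      rw [hT', LieModule.traceForm_apply_lie_apply]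
    rw [hskew x, ← h1] at h2
    exact self_eq_neg.mp h2
  ext x
  exact LieAlgebra.IsSemisimple.map_eq_zero_of_mem (I := (⊤ : LieIdeal K L)) T
    (fun y _ z _ ↦ hbr y z) (LieSubmodule.mem_top x)

/-- The left inclusion into a direct product of Lie algebras. -/
def prodInlHom (K L M : Type*) [CommRing K] [LieRing L] [LieAlgebra K L] [LieRing M]
    [LieAlgebra K M] : L →ₗ⁅K⁆ L × M where
  __ := LinearMap.inl K L M
  map_lie' {_ _} := Prod.ext rfl (lie_self (0 : M)).symm

lemma TensorProduct.comm_lie {K L : Type*} [CommRing K] [LieRing L] [LieAlgebra K L] (x : L)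
    (t : L ⊗[K] L) : TensorProduct.comm K L L ⁅x, t⁆ = ⁅x, TensorProduct.comm K L L t⁆ := by
  induction t with
  | zero => simp
  | add s t hs ht => simp only [lie_add, map_add, hs, ht]
  | tmul a b =>
    simp only [TensorProduct.LieModule.lie_tmul_right, map_add, TensorProduct.comm_tmul]
    rw [add_comm]

/-- A tensor can be made antisymmetric without changing those of its translates that already are
antisymmetric. -/
lemma TensorProduct.exists_antisymm_lie_eq {K L : Type*} [Field K] [CharZero K] [LieRing L]
    [LieAlgebra K L] (r : L ⊗[K] L) :
    ∃ s : L ⊗[K] L, TensorProduct.comm K L L s = - s ∧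
      ∀ x : L, TensorProduct.comm K L L ⁅x, r⁆ = - ⁅x, r⁆ → ⁅x, s⁆ = ⁅x, r⁆ := by
  refine ⟨(2⁻¹ : K) • (r - TensorProduct.comm K L L r), ?_, fun x hx ↦ ?_⟩
  · rw [map_smul, map_sub, TensorProduct.comm_comm, ← smul_neg, neg_sub]
  · rw [lie_smul, lie_sub, ← TensorProduct.comm_lie, hx, sub_neg_eq_add, ← two_smul K,
      smul_smul, inv_mul_cancel₀ two_ne_zero, one_smul]

section

variable {K g V : Type*} [Field K] [CharZero K] [LieRing g] [LieAlgebra K g]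
  [FiniteDimensional K g] [LieAlgebra.IsSemisimple K g] [LieRing V] [LieAlgebra K V]

/-- Contracting an antisymmetric invariant tensor of `g × V` gives an element of `V`. -/
lemma fst_contractSnd_eq_zero {t : (g × V) ⊗[K] (g × V)}
    (hanti : TensorProduct.comm K (g × V) (g × V) t = - t) (hinv : ∀ x : g × V, ⁅x, t⁆ = 0)
    (ψ : g × V →ₗ[K] K) : (contractSnd K (g × V) (g × V) ψ t).1 = 0 := by
  have hlie (ψ : g × V →ₗ[K] K) (x : g) :
      (contractSnd K (g × V) (g × V) (ψ ∘ₗ LieModule.toEnd K (g × V) (g × V) (x, 0)) t).1 =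
        - ⁅x, (contractSnd K (g × V) (g × V) ψ t).1⁆ := by
    have := contractSnd_lie ψ ((x, 0) : g × V) t
    rw [hinv, map_zero] at this
    exact congrArg Prod.fst (eq_neg_of_add_eq_zero_right this.symm)
  have hsnd (ψ : V →ₗ[K] K) :
      (contractSnd K (g × V) (g × V) (ψ ∘ₗ LinearMap.snd K g V) t).1 = 0 := by
    rw [← LieSubmodule.mem_bot (R := K) (L := g), ← LieAlgebra.center_eq_bot K g,
      LieModule.mem_maxTrivSubmodule]
    intro x
    have hzero : (ψ ∘ₗ LinearMap.snd K g V) ∘ₗ LieModule.toEnd K (g × V) (g × V) (x, 0) = 0 := by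
      ext y
      · exact (congrArg ψ (zero_lie (0 : V))).trans ψ.map_zero
      · exact (congrArg ψ (zero_lie (y : V))).trans ψ.map_zero
    have := hlie (ψ ∘ₗ LinearMap.snd K g V) x
    rw [hzero, map_zero] at this
    exact neg_eq_zero.mp this.symm
  let T : g →ₗ[K] g := LinearMap.fst K g V ∘ₗ (contractSnd K (g × V) (g × V)).flip t ∘ₗ
    (LinearMap.fst K g V).dualMap ∘ₗ killingForm K g
  have hTapp (y : g) : T y =
      (contractSnd K (g × V) (g × V) (killingForm K g y ∘ₗ LinearMap.fst K g V) t).1 := rfl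
  have hT : T = 0 := by
    refine LieAlgebra.IsKilling.eq_zero_of_equivariant_of_skew (fun x y ↦ ?_) fun x y ↦ ?_
    · have hcomp : (killingForm K g y ∘ₗ LinearMap.fst K g V) ∘ₗ
          LieModule.toEnd K (g × V) (g × V) (x, 0) =
            - (killingForm K g ⁅x, y⁆ ∘ₗ LinearMap.fst K g V) := by
        refine LinearMap.ext fun z ↦ ?_
        change killingForm K g y ⁅x, z.1⁆ = - killingForm K g ⁅x, y⁆ z.1
        rw [LieModule.traceForm_apply_lie_apply', neg_neg]
      have := hlie (killingForm K g y ∘ₗ LinearMap.fst K g V) x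
      rw [hcomp, map_neg] at this
      exact neg_injective this
    · have := apply_contractSnd_comm (killingForm K g x ∘ₗ LinearMap.fst K g V)
        (killingForm K g y ∘ₗ LinearMap.fst K g V) t
      rw [hanti, map_neg, map_neg] at this
      rw [hTapp, hTapp, LieModule.traceForm_comm, eq_neg_iff_add_eq_zero, ← neg_eq_iff_add_eq_zero]
      exact this
  obtain ⟨y, hy⟩ : ∃ y, killingForm K g y = ψ ∘ₗ LinearMap.inl K g V := by
    have hnd := LieAlgebra.IsKilling.killingForm_nondegenerate K g
    exact ⟨(LinearMap.BilinForm.toDual _ hnd).symm (ψ ∘ₗ LinearMap.inl K g V),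
      (LinearMap.BilinForm.toDual _ hnd).apply_symm_apply _⟩
  have hψ : ψ = killingForm K g y ∘ₗ LinearMap.fst K g V +
      (ψ ∘ₗ LinearMap.inr K g V) ∘ₗ LinearMap.snd K g V := by
    refine LinearMap.ext fun z ↦ ?_
    rw [hy]
    exact (congrArg ψ (Prod.fst_add_snd z).symm).trans (ψ.map_add _ _)
  rw [hψ, map_add, LinearMap.add_apply, Prod.fst_add, hsnd, ← hTapp, hT, LinearMap.zero_apply,
    add_zero]

/-- An antisymmetric invariant tensor of `g × V` lies in `V ⊗ V`. -/
lemma map_inr_map_snd_of_invariant {t : (g × V) ⊗[K] (g × V)}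
    (hanti : TensorProduct.comm K (g × V) (g × V) t = - t) (hinv : ∀ x : g × V, ⁅x, t⁆ = 0) :
    TensorProduct.map (LinearMap.inr K g V) (LinearMap.inr K g V)
      (TensorProduct.map (LinearMap.snd K g V) (LinearMap.snd K g V) t) = t := by
  let p : g × V →ₗ[K] g × V := LinearMap.inr K g V ∘ₗ LinearMap.snd K g V
  have hr : p.rTensor (g × V) t = t := by
    rw [← sub_eq_zero]
    refine eq_zero_of_contractSnd fun ψ ↦ ?_
    rw [map_sub, contractSnd_rTensor, sub_eq_zero]
    exact Prod.ext (fst_contractSnd_eq_zero hanti hinv ψ).symm rfl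
  have hl : p.lTensor (g × V) t = t := by
    have := LinearMap.congr_fun (LinearMap.comm_comp_rTensor_comp_comm_eq (Q := g × V) p) t
    simp only [LinearMap.comp_apply, LinearEquiv.coe_coe, hanti, map_neg, hr, neg_neg] at this
    exact this.symm
  calc _ = p.rTensor (g × V) (p.lTensor (g × V) t) := by
        rw [← LinearMap.comp_apply, ← LinearMap.comp_apply, LinearMap.rTensor_comp_lTensor,
          ← TensorProduct.map_comp]
    _ = t := by rw [hl, hr]

end

/-- on l = g × V with g finite-dimensional semisimple and V a
finite-dimensional abelian Lie algebra, every antisymmetric 1-cocycle is of the form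
δ(w) = w · r + (ι ⊗ ι)(φ(π_V w)). -/
theorem cocycle_on_semisimple_times_abelian
    {K : Type*} [Field K] [CharZero K]
    {g : Type*} [LieRing g] [LieAlgebra K g] [FiniteDimensional K g]
    [LieAlgebra.IsSemisimple K g]
    {V : Type*} [LieRing V] [LieAlgebra K V] [IsLieAbelian V] [FiniteDimensional K V]
    (δ : (g × V) →ₗ[K] (g × V) ⊗[K] (g × V))
    (hanti : IsAntisym δ) (hcoc : IsCocycle δ) :
    ∃ (r : (g × V) ⊗[K] (g × V)) (φ : V →ₗ[K] V ⊗[K] V),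
      TensorProduct.comm K (g × V) (g × V) r = - r ∧
      ∀ w : g × V, δ w = ⁅w, r⁆ +
        (TensorProduct.map
          ((LinearMap.inr K g V) : V →ₗ[K] g × V)
          ((LinearMap.inr K g V) : V →ₗ[K] g × V)) (φ w.2) := by
  have hcentral (v : V) (x : g × V) : ⁅((0, v) : g × V), x⁆ = 0 :=
    Prod.ext (zero_lie x.1) (trivial_lie_zero V V v x.2)
  have hcentral' (v : V) (t : (g × V) ⊗[K] (g × V)) : ⁅((0, v) : g × V), t⁆ = 0 := by
    induction t with
    | zero => exact lie_zero _
    | add s t hs ht => rw [lie_add, hs, ht, add_zero]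
    | tmul a b =>
      rw [TensorProduct.LieModule.lie_tmul_right, hcentral, hcentral, zero_tmul, tmul_zero,
        add_zero]
  have hinv (v : V) (x : g × V) : ⁅x, δ (0, v)⁆ = 0 := by
    have := hcoc (0, v) x
    rw [hcentral, hcentral', map_zero, zero_sub] at this
    exact neg_eq_zero.mp this.symm
  obtain ⟨r, hr⟩ := (prodInlHom K g V).exists_lie_eq_of_cocycle
    (δ ∘ₗ (prodInlHom K g V : g →ₗ[K] g × V)) fun x y ↦ by
      simp only [LinearMap.comp_apply, LieHom.coe_toLinearMap, LieHom.map_lie]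
      exact hcoc _ _
  obtain ⟨s, hs, hsr⟩ := TensorProduct.exists_antisymm_lie_eq r
  refine ⟨s,
    TensorProduct.map (LinearMap.snd K g V) (LinearMap.snd K g V) ∘ₗ δ ∘ₗ LinearMap.inr K g V,
    hs, fun w ↦ ?_⟩
  have hg (x : g) : δ (x, 0) = ⁅((x, 0) : g × V), s⁆ := by
    have h1 : δ (x, 0) = ⁅((x, 0) : g × V), r⁆ := hr x
    rw [hsr _ (h1 ▸ hanti (x, 0)), h1]
  have hw : w = ((w.1, 0) : g × V) + (0, w.2) := by simp
  have hV := map_inr_map_snd_of_invariant (hanti (0, w.2)) (hinv w.2)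
  have hlie (t : (g × V) ⊗[K] (g × V)) : ⁅w, t⁆ = ⁅((w.1, 0) : g × V), t⁆ := by
    conv_lhs => rw [hw, add_lie, hcentral', add_zero]
  rw [hlie, ← hg]
  conv_lhs => rw [hw, map_add, ← hV]
  rfl
end

section
/- Let (g, δ) be a Lie bialgebra over K. Then the characteristic map 𝒟 = β ∘ δ is a biderivation of (g, δ): it is a derivation of the Lie bracket and a coderivation of δ. -/
open TensorProduct

section CharacteristicMap

variable {K : Type*} [CommRing K] {L : Type*} [LieRing L] [LieAlgebra K L]

@[simp]
lemma bracketMap_tmul (a b : L) : bracketMap K L (a ⊗ₜ[K] b) = ⁅a, b⁆ := by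
  simp [bracketMap, bracketBilin]

@[simp]
lemma cyc_tmul (a b c : L) :
    cyc K L (a ⊗ₜ[K] (b ⊗ₜ[K] c)) = c ⊗ₜ[K] (a ⊗ₜ[K] b) := by
  simp [cyc]

/-- The bracket map `β` is a morphism of Lie modules. -/
lemma bracketMap_lie (x : L) (t : L ⊗[K] L) :
    bracketMap K L ⁅x, t⁆ = ⁅x, bracketMap K L t⁆ := by
  induction t with
  | zero => simp
  | add s t hs ht => simp [hs, ht]
  | tmul a b =>
    simp only [TensorProduct.LieModule.lie_tmul_right, map_add, bracketMap_tmul]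
    exact (leibniz_lie x a b).symm

/-- The linear map `a ⊗ b ↦ b · δ a`. -/
noncomputable def coadjointAction (δ : L →ₗ[K] L ⊗[K] L) : L ⊗[K] L →ₗ[K] L ⊗[K] L :=
  TensorProduct.lift
    ((LieModule.toEnd K L (L ⊗[K] L) : L →ₗ[K] Module.End K (L ⊗[K] L)).flip ∘ₗ δ)

@[simp]
lemma coadjointAction_tmul (δ : L →ₗ[K] L ⊗[K] L) (a b : L) :
    coadjointAction δ (a ⊗ₜ[K] b) = ⁅b, δ a⁆ := by
  simp [coadjointAction]

lemma IsCocycle.apply_bracketMap {δ : L →ₗ[K] L ⊗[K] L} (hδ : IsCocycle δ) (t : L ⊗[K] L) :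
    δ (bracketMap K L t) =
      coadjointAction δ (TensorProduct.comm K L L t) - coadjointAction δ t := by
  induction t with
  | zero => simp
  | add s t hs ht => simp only [map_add, hs, ht]; abel
  | tmul a b => simp [hδ a b]

/-- The difference of the maps `a ⊗ b ⊗ c ↦ ⁅a, b⁆ ⊗ c` and `a ⊗ b ⊗ c ↦ a ⊗ ⁅b, c⁆`. -/
noncomputable def bracketDifference : L ⊗[K] (L ⊗[K] L) →ₗ[K] L ⊗[K] L :=
  (bracketMap K L).rTensor L ∘ₗ (TensorProduct.assoc K L L L).symm.toLinearMap -
    (bracketMap K L).lTensor L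

@[simp]
lemma bracketDifference_tmul (a b c : L) :
    bracketDifference (a ⊗ₜ[K] (b ⊗ₜ[K] c)) = ⁅a, b⁆ ⊗ₜ[K] c - a ⊗ₜ[K] ⁅b, c⁆ := by
  simp [bracketDifference]

/-- The sum of a tensor over the cyclic permutations of its three factors. -/
noncomputable def cyclicSum : L ⊗[K] (L ⊗[K] L) →ₗ[K] L ⊗[K] (L ⊗[K] L) :=
  LinearMap.id + (cyc K L).toLinearMap + (cyc K L).toLinearMap ∘ₗ (cyc K L).toLinearMap

lemma bracketDifference_cyclicSum_assoc_tmul (s : L ⊗[K] L) (b : L) :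
    bracketDifference (cyclicSum (TensorProduct.assoc K L L L (s ⊗ₜ[K] b))) =
      bracketMap K L s ⊗ₜ[K] b - b ⊗ₜ[K] bracketMap K L s
        + ⁅b, s⁆ - ⁅b, TensorProduct.comm K L L s⁆ := by
  induction s with
  | zero => simp
  | add s t hs ht =>
    simp only [TensorProduct.add_tmul, TensorProduct.tmul_add, map_add, lie_add, hs, ht]
    abel
  | tmul p q =>
    simp only [cyclicSum, LinearMap.add_apply, LinearMap.comp_apply, LinearMap.id_apply,
      LinearEquiv.coe_coe, TensorProduct.assoc_tmul, cyc_tmul, map_add, bracketDifference_tmul,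
      bracketMap_tmul, TensorProduct.comm_tmul, TensorProduct.LieModule.lie_tmul_right]
    rw [← lie_skew b q, TensorProduct.neg_tmul, TensorProduct.tmul_neg]
    abel

lemma IsAntisym.bracketDifference_cyclicSum {δ : L →ₗ[K] L ⊗[K] L} (hδ : IsAntisym δ)
    (t : L ⊗[K] L) :
    bracketDifference (cyclicSum
        (TensorProduct.assoc K L L L (TensorProduct.map δ LinearMap.id t))) =
      TensorProduct.map (bracketMap K L ∘ₗ δ) LinearMap.id t
        - TensorProduct.map LinearMap.id (bracketMap K L ∘ₗ δ) (TensorProduct.comm K L L t)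
        + (coadjointAction δ t + coadjointAction δ t) := by
  induction t with
  | zero => simp
  | add s t hs ht => simp only [map_add, hs, ht]; abel
  | tmul a b =>
    simp only [TensorProduct.map_tmul, LinearMap.id_apply, TensorProduct.comm_tmul,
      LinearMap.comp_apply, coadjointAction_tmul, bracketDifference_cyclicSum_assoc_tmul,
      hδ a, lie_neg]
    abel

lemma IsCocycle.isDerivation_bracketMap_comp {δ : L →ₗ[K] L ⊗[K] L} (hδ : IsCocycle δ) :
    IsDerivation (bracketMap K L ∘ₗ δ) := by
  intro x y
  simp only [LinearMap.comp_apply, hδ x y, map_sub, bracketMap_lie]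
  rw [← lie_skew (bracketMap K L (δ x)) y]
  abel

lemma IsLieBialgebra.isCoderivation_bracketMap_comp {δ : L →ₗ[K] L ⊗[K] L}
    (hδ : IsLieBialgebra δ) : IsCoderivation δ (bracketMap K L ∘ₗ δ) := by
  obtain ⟨hanti, hcocycle, hjacobi⟩ := hδ
  intro x
  have hsum : cyclicSum
      (TensorProduct.assoc K L L L (TensorProduct.map δ LinearMap.id (δ x))) = 0 :=
    hjacobi x
  have h := hanti.bracketDifference_cyclicSum (δ x)
  rw [hsum, map_zero, hanti x, map_neg, sub_neg_eq_add] at h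
  rw [LinearMap.add_apply, LinearMap.comp_apply, hcocycle.apply_bracketMap, hanti x, map_neg,
    eq_neg_of_add_eq_zero_left h.symm]
  abel

end CharacteristicMap

/-- the characteristic map 𝒟 = β ∘ δ of a Lie bialgebra is a biderivation. -/
theorem characteristic_map_is_biderivation
    {K : Type*} [Field K] [CharZero K] {L : Type*} [LieRing L] [LieAlgebra K L]
    (δ : L →ₗ[K] L ⊗[K] L) (hδ : IsLieBialgebra δ) :
    IsBiderivation δ (bracketMap K L ∘ₗ δ) :=
  ⟨hδ.2.1.isDerivation_bracketMap_comp, hδ.isCoderivation_bracketMap_comp⟩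
end

section
/- Let (g, δ) be a Lie bialgebra over K with characteristic map 𝒟 = β ∘ δ. Then every biderivation E of (g, δ) commutes with 𝒟: E ∘ 𝒟 = 𝒟 ∘ E. -/
open TensorProduct

/-- A derivation of the bracket intertwines `β` with `D ⊗ id + id ⊗ D`. -/
theorem IsDerivation.comp_bracketMap {K : Type*} [CommRing K] {L : Type*} [LieRing L]
    [LieAlgebra K L] {D : L →ₗ[K] L} (hD : IsDerivation D) :
    D ∘ₗ bracketMap K L = bracketMap K L ∘ₗ
      (TensorProduct.map D (LinearMap.id : L →ₗ[K] L)
        + TensorProduct.map (LinearMap.id : L →ₗ[K] L) D) := by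
  ext x y
  simpa [bracketMap, bracketBilin] using hD x y

/-- every biderivation of a Lie bialgebra commutes with the characteristic
map 𝒟 = β ∘ δ. -/
theorem biderivation_commutes_with_characteristic_map
    {K : Type*} [Field K] [CharZero K] {L : Type*} [LieRing L] [LieAlgebra K L]
    (δ : L →ₗ[K] L ⊗[K] L) (hδ : IsLieBialgebra δ)
    (E : L →ₗ[K] L) (hE : IsBiderivation δ E) :
    E ∘ₗ (bracketMap K L ∘ₗ δ) = (bracketMap K L ∘ₗ δ) ∘ₗ E := by
  ext x
  have h := LinearMap.congr_fun hE.1.comp_bracketMap (δ x)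
  simpa only [LinearMap.comp_apply, hE.2 x] using h
end

section
/- Let (g, δ) be a Lie bialgebra over K whose characteristic map is inner, say 𝒟 = ad_{H₀} for some H₀ ∈ g. Then: (1) for every biderivation E of (g, δ), E(H₀) lies in the center Z(g); (2) if moreover E = ad_x for some x ∈ g, then ⁅x, H₀⁆ ∈ Z(g); in particular, if Z(g) = 0 then ⁅x, H₀⁆ = 0. -/
open TensorProduct

/-- The map induced by the bracket intertwines a derivation `D` with `D ⊗ id + id ⊗ D`. -/
theorem IsDerivation.map_bracketMap {K L : Type*} [CommRing K] [LieRing L] [LieAlgebra K L]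
    {D : L →ₗ[K] L} (hD : IsDerivation D) (t : L ⊗[K] L) :
    D (bracketMap K L t) = bracketMap K L ((TensorProduct.map D LinearMap.id
      + TensorProduct.map LinearMap.id D : L ⊗[K] L →ₗ[K] L ⊗[K] L) t) := by
  induction t with
  | zero => simp
  | tmul a b => simp [bracketMap, bracketBilin, hD a b]
  | add s t hs ht => rw [map_add, map_add, hs, ht, map_add, map_add]

/-- A biderivation commutes with the characteristic map. -/
theorem IsBiderivation.map_characteristicMap {K L : Type*} [CommRing K] [LieRing L]
    [LieAlgebra K L] {δ : L →ₗ[K] L ⊗[K] L} {E : L →ₗ[K] L} (hE : IsBiderivation δ E) (x : L) :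
    E ((bracketMap K L ∘ₗ δ) x) = (bracketMap K L ∘ₗ δ) (E x) := by
  rw [LinearMap.comp_apply, LinearMap.comp_apply, hE.1.map_bracketMap, hE.2 x]

/-- if the characteristic map of a Lie bialgebra is inner, 𝒟 = ad_{H₀}, then
(1) every biderivation E satisfies E(H₀) ∈ Z(g); (2) if E = ad_x is a biderivation then
⁅x, H₀⁆ ∈ Z(g), and if Z(g) = 0 then ⁅x, H₀⁆ = 0. -/
theorem biderivation_of_inner_characteristic_map
    {K : Type*} [Field K] [CharZero K] {L : Type*} [LieRing L] [LieAlgebra K L]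
    (δ : L →ₗ[K] L ⊗[K] L) (hδ : IsLieBialgebra δ)
    (H₀ : L) (hinner : ∀ x : L, (bracketMap K L ∘ₗ δ) x = ⁅H₀, x⁆) :
    (∀ E : L →ₗ[K] L, IsBiderivation δ E → E H₀ ∈ LieAlgebra.center K L) ∧
    (∀ x : L, IsBiderivation δ (LieAlgebra.ad K L x) →
      ⁅x, H₀⁆ ∈ LieAlgebra.center K L) ∧
    (LieAlgebra.center K L = ⊥ →
      ∀ x : L, IsBiderivation δ (LieAlgebra.ad K L x) → ⁅x, H₀⁆ = 0) := by
  have key : ∀ E : L →ₗ[K] L, IsBiderivation δ E → E H₀ ∈ LieAlgebra.center K L := by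
    intro E hE
    rw [LieModule.mem_maxTrivSubmodule]
    intro x
    have h := hE.map_characteristicMap x
    rw [hinner, hinner, hE.1, add_eq_right] at h
    rw [← lie_skew, h, neg_zero]
  refine ⟨key, fun x hx => key _ hx, fun hZ x hx => ?_⟩
  have h := key _ hx
  rwa [hZ, LieSubmodule.mem_bot] at h
end

section
/- Let g be a finite-dimensional semisimple complex Lie algebra and let r ∈ g ⊗ g be such that: r satisfies the classical Yang–Baxter equation; the symmetric part s := r + swap(r) is g-invariant; and the linear map g* → g, f ↦ (f ⊗ id)(s), is bijective (so that δ(x) := x · r is a factorizable Lie bialgebra structure on g). Then H_r := β(r) is a regular element of g, and its centralizer Z_g(H_r) = {x ∈ g : ⁅x, H_r⁆ = 0} is a Cartan subalgebra of g. -/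
open TensorProduct

/-- The centralizer of an element `H`, as a Lie subalgebra. -/
def centralizerOf (K : Type*) [CommRing K] (L : Type*) [LieRing L] [LieAlgebra K L]
    (H : L) : LieSubalgebra K L where
  carrier := {x : L | ⁅x, H⁆ = 0}
  add_mem' := fun {a b} ha hb => by
    simp only [Set.mem_setOf_eq] at *; rw [add_lie, ha, hb, add_zero]
  zero_mem' := zero_lie H
  smul_mem' := fun t a ha => by
    simp only [Set.mem_setOf_eq] at *; rw [smul_lie, ha, smul_zero]
  lie_mem' := fun {a b} ha hb => by
    simp only [Set.mem_setOf_eq] at *; rw [lie_lie, ha, hb]; simp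

/-- `r ∈ L ⊗ L` satisfies the classical Yang-Baxter equation:
for some (equivalently, any) representation `r = Σᵢ aᵢ ⊗ bᵢ` one has
`[r¹², r¹³] + [r¹², r²³] + [r¹³, r²³] = 0` in `L ⊗ L ⊗ L`. -/
def SatisfiesCYBE {K : Type*} [CommRing K] {L : Type*} [LieRing L] [LieAlgebra K L]
    (r : L ⊗[K] L) : Prop :=
  ∃ (n : ℕ) (a b : Fin n → L),
    r = ∑ i, a i ⊗ₜ[K] b i ∧
    ∑ i, ∑ j,
      ((⁅a i, a j⁆ ⊗ₜ[K] (b i ⊗ₜ[K] b j))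
        + (a i ⊗ₜ[K] (⁅b i, a j⁆ ⊗ₜ[K] b j))
        + (a i ⊗ₜ[K] (a j ⊗ₜ[K] ⁅b i, b j⁆))) = (0 : L ⊗[K] (L ⊗[K] L))

/-- The symmetric part `r + r²¹` of `r`. -/
noncomputable def symPart {K : Type*} [CommRing K] {L : Type*} [LieRing L]
    [LieAlgebra K L] (r : L ⊗[K] L) : L ⊗[K] L :=
  r + TensorProduct.comm K L L r

/-- `(g, r)` is factorizable: `r` satisfies CYBE, its symmetric part `s` is invariant and
the induced map `g* → g`, `f ↦ (f ⊗ id) s`, is bijective. -/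
noncomputable def IsFactorizableRMatrix {K : Type*} [CommRing K] {L : Type*} [LieRing L]
    [LieAlgebra K L] (r : L ⊗[K] L) : Prop :=
  SatisfiesCYBE r ∧ (∀ x : L, ⁅x, symPart r⁆ = 0) ∧
    Function.Bijective (fun f : Module.Dual K L =>
      TensorProduct.lid K L
        ((TensorProduct.map f (LinearMap.id : L →ₗ[K] L)) (symPart r)))

section Regular

variable {g : Type*} [LieRing g] [LieAlgebra ℂ g] [FiniteDimensional ℂ g]

lemma isCartanSubalgebra_engel_of_isRegular {x : g} (hx : LieAlgebra.IsRegular ℂ x) :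
    (LieSubalgebra.engel ℂ x).IsCartanSubalgebra := by
  have h : (Module.finrank ℂ g : Cardinal) ≤ Cardinal.mk ℂ :=
    Cardinal.natCast_le_aleph0.trans <| Cardinal.infinite_iff.mp inferInstance
  refine ⟨?_, LieSubalgebra.normalizer_engel _ _⟩
  apply LieSubalgebra.isNilpotent_of_forall_le_engel
  intro y hy
  set Ex : {LieSubalgebra.engel ℂ z | z ∈ LieSubalgebra.engel ℂ x} :=
    ⟨LieSubalgebra.engel ℂ x, x, LieSubalgebra.self_mem_engel _ _, rfl⟩
  suffices IsBot Ex from @this ⟨LieSubalgebra.engel ℂ y, y, hy, rfl⟩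
  apply LieAlgebra.engel_isBot_of_isMin h (LieSubalgebra.engel ℂ x) Ex le_rfl
  rintro ⟨_, y, hy, rfl⟩ hyx
  suffices Module.finrank ℂ (LieSubalgebra.engel ℂ x) ≤
      Module.finrank ℂ (LieSubalgebra.engel ℂ y) by
    suffices LieSubalgebra.engel ℂ y = LieSubalgebra.engel ℂ x from this.ge
    apply LieSubalgebra.toSubmodule_injective
    exact Submodule.eq_of_le_of_finrank_le hyx this
  rw [(LieAlgebra.isRegular_iff_finrank_engel_eq_rank ℂ x).mp hx]
  apply LieAlgebra.rank_le_finrank_engel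

lemma isRegular_congr_charpoly {x y : g}
    (h : (LieAlgebra.ad ℂ g x).charpoly = (LieAlgebra.ad ℂ g y).charpoly) :
    LieAlgebra.IsRegular ℂ x ↔ LieAlgebra.IsRegular ℂ y := by
  rw [LieAlgebra.isRegular_def, LieAlgebra.isRegular_def, h]

lemma centralizerOf_eq_engel_of_isRegular [LieAlgebra.IsKilling ℂ g] {x : g}
    (hx : LieAlgebra.IsRegular ℂ x) :
    centralizerOf ℂ g x = LieSubalgebra.engel ℂ x := by
  have := isCartanSubalgebra_engel_of_isRegular hx
  apply le_antisymm
  · intro y hy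
    rw [LieSubalgebra.mem_engel_iff]
    refine ⟨1, ?_⟩
    have h : ⁅y, x⁆ = 0 := hy
    rw [pow_one, LieAlgebra.ad_apply, ← lie_skew, h, neg_zero]
  · intro y hy
    have h := trivial_lie_zero (LieSubalgebra.engel ℂ x) (LieSubalgebra.engel ℂ x)
      ⟨y, hy⟩ ⟨x, LieSubalgebra.self_mem_engel _ _⟩
    exact congrArg Subtype.val h

end Regular

section Triangular

lemma exists_basis_lower_triangular (A : Type*) [LieRing A] [LieAlgebra ℂ A]
    [FiniteDimensional ℂ A] [LieAlgebra.IsSolvable A] (n : ℕ) (V : Type*) [AddCommGroup V]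
    [Module ℂ V] [LieRingModule A V] [LieModule ℂ A V] [FiniteDimensional ℂ V]
    (hn : Module.finrank ℂ V = n) :
    ∃ B : Module.Basis (Fin n) ℂ V, ∀ x : A, ∀ i j, i < j →
      LinearMap.toMatrix B B (LieModule.toEnd ℂ A V x) i j = 0 := by
  induction n generalizing V with
  | zero => exact ⟨Module.finBasisOfFinrankEq ℂ V hn, fun x i => i.elim0⟩
  | succ n ih =>
    have : Nontrivial V := Module.nontrivial_of_finrank_pos (R := ℂ) (by omega)
    have : Nontrivial (Module.Dual ℂ V) := inferInstance
    obtain ⟨χ, hχ⟩ := LieModule.exists_nontrivial_weightSpace_of_isSolvable ℂ A (Module.Dual ℂ V)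
    obtain ⟨⟨φ, hφ⟩, hφ0⟩ := exists_ne (0 : LieModule.weightSpace (Module.Dual ℂ V) χ)
    have hφ1 : φ ≠ 0 := fun h => hφ0 (Subtype.ext h)
    rw [LieModule.mem_weightSpace] at hφ
    let N : LieSubmodule ℂ A V :=
      { LinearMap.ker φ with
        lie_mem := by
          intro x v hv
          have h1 := LinearMap.congr_fun (hφ x) v
          have hv' : φ v = 0 := hv
          change φ ⁅x, v⁆ = 0
          rw [Module.Dual.lie_apply] at h1
          simpa [hv'] using h1 }
    have hN : ∀ v, v ∈ N ↔ φ v = 0 := fun v => Iff.rfl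
    have hr : Module.finrank ℂ N = n := by
      have h1 := LinearMap.finrank_range_add_finrank_ker φ
      have h2 : LinearMap.range φ = ⊤ := LinearMap.range_eq_top.2 (LinearMap.surjective hφ1)
      rw [h2, finrank_top, Module.finrank_self] at h1
      have h3 : Module.finrank ℂ N = Module.finrank ℂ (LinearMap.ker φ) := rfl
      omega
    obtain ⟨B, hB⟩ := ih N hr
    obtain ⟨v, hv⟩ := LinearMap.surjective hφ1 1
    let C : Module.Basis (Fin (n+1)) ℂ V := Module.Basis.mkFinCons (N := N.toSubmodule) v B
      (by
        intro c x hx h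
        have h1 := congrArg φ h
        have hx' : φ x = 0 := hx
        simpa [hv, hx'] using h1)
      (by
        intro z
        refine ⟨-φ z, ?_⟩
        change φ _ = 0
        simp [hv])
    refine ⟨C, fun x i j hij => ?_⟩
    have key : ∀ w : N, ∀ i : Fin n, C.repr (w : V) i.succ = B.repr w i ∧ C.repr (w : V) 0 = 0 := by
      intro w i
      have : (w : V) = ∑ k, B.repr w k • C k.succ := by
        have h := congrArg Subtype.val (B.sum_repr w)
        rw [AddSubmonoidClass.coe_finsetSum] at h
        simpa [C] using h.symm
      rw [this]
      simp [Finsupp.single_apply, Fin.succ_ne_zero]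
    obtain ⟨k, rfl⟩ := Fin.exists_succ_eq_of_ne_zero (Fin.ne_zero_of_lt hij)
    have hC : C k.succ = (B k : V) := by simp [C]
    rw [LinearMap.toMatrix_apply, hC]
    have h2 : LieModule.toEnd ℂ A V x (B k : V) = ((LieModule.toEnd ℂ A N x (B k) : N) : V) := rfl
    rw [h2]
    refine Fin.cases (fun _ => ?_) (fun i hij => ?_) i hij
    · exact (key _ k).2
    · rw [(key _ i).1, ← LinearMap.toMatrix_apply]
      exact hB x i k (Fin.succ_lt_succ_iff.1 hij)

end Triangular

section Derived

open LieAlgebra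

variable {g : Type*} [LieRing g] [LieAlgebra ℂ g]

lemma isSolvable_of_isSolvable_derivedSeries_one {A : Type*} [LieRing A] [LieAlgebra ℂ A]
    (h : IsSolvable (derivedSeries ℂ A 1)) : IsSolvable A := by
  obtain ⟨k, hk⟩ := (isSolvable_iff ℂ (L := derivedSeries ℂ A 1)).1 h
  rw [LieIdeal.derivedSeries_eq_bot_iff, LieAlgebra.derivedSeries, ← derivedSeriesOfIdeal_add] at hk
  exact (isSolvable_iff ℂ A).2 ⟨k + 1, hk⟩

/-- The subalgebra spanned by brackets of elements of `A`. -/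
def LieSubalgebra.derived (A : LieSubalgebra ℂ g) : LieSubalgebra ℂ g where
  __ := Submodule.span ℂ {z | ∃ x ∈ A, ∃ y ∈ A, ⁅x, y⁆ = z}
  lie_mem' := by
    intro a b ha hb
    have h : Submodule.span ℂ {z | ∃ x ∈ A, ∃ y ∈ A, ⁅x, y⁆ = z} ≤ A.toSubmodule := by
      rw [Submodule.span_le]
      rintro _ ⟨x, hx, y, hy, rfl⟩
      exact A.lie_mem hx hy
    exact Submodule.subset_span ⟨a, h ha, b, h hb, rfl⟩

lemma LieSubalgebra.lie_mem_derived {A : LieSubalgebra ℂ g} {x y : g} (hx : x ∈ A) (hy : y ∈ A) :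
    ⁅x, y⁆ ∈ A.derived := Submodule.subset_span ⟨x, hx, y, hy, rfl⟩

lemma LieSubalgebra.derived_induction {A : LieSubalgebra ℂ g} {S : Submodule ℂ g}
    (h : ∀ x ∈ A, ∀ y ∈ A, ⁅x, y⁆ ∈ S) {z : g} (hz : z ∈ A.derived) : z ∈ S := by
  have : Submodule.span ℂ {z | ∃ x ∈ A, ∃ y ∈ A, ⁅x, y⁆ = z} ≤ S := by
    rw [Submodule.span_le]
    rintro _ ⟨x, hx, y, hy, rfl⟩
    exact h x hx y hy
  exact this hz

lemma LieSubalgebra.derived_le (A : LieSubalgebra ℂ g) : A.derived ≤ A := fun _ hz =>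
  LieSubalgebra.derived_induction (S := A.toSubmodule) (fun _ hx _ hy => A.lie_mem hx hy) hz

lemma LieSubalgebra.isSolvable_of_derived {A : LieSubalgebra ℂ g} (h : IsSolvable A.derived) :
    IsSolvable A := by
  apply isSolvable_of_isSolvable_derivedSeries_one
  have key : ∀ z ∈ derivedSeries ℂ A 1, (z : g) ∈ A.derived := by
    intro z hz
    have : derivedSeries ℂ A 1 = ⁅(⊤ : LieIdeal ℂ A), (⊤ : LieIdeal ℂ A)⁆ := rfl
    rw [this, ← LieSubmodule.mem_toSubmodule, LieSubmodule.lieIdeal_oper_eq_linear_span'] at hz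
    have : Submodule.span ℂ {x : A | ∃ a ∈ (⊤ : LieIdeal ℂ A), ∃ b ∈ (⊤ : LieIdeal ℂ A),
        ⁅a, b⁆ = x} ≤ A.derived.toSubmodule.comap A.toSubmodule.subtype := by
      rw [Submodule.span_le]
      rintro _ ⟨a, -, b, -, rfl⟩
      exact LieSubalgebra.lie_mem_derived a.2 b.2
    exact this hz
  let F : derivedSeries ℂ A 1 →ₗ⁅ℂ⁆ A.derived :=
    { toFun := fun z => ⟨z, key z z.2⟩
      map_add' := fun _ _ => rfl
      map_smul' := fun _ _ => rfl
      map_lie' := rfl }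
  have hF : Function.Injective F := fun a b hab => by
    have := congrArg (Subtype.val) hab
    exact Subtype.ext (Subtype.ext this)
  exact hF.lieAlgebra_isSolvable

end Derived

section Triangular

open LieAlgebra

variable {g : Type*} [LieRing g] [LieAlgebra ℂ g] [FiniteDimensional ℂ g]

lemma exists_basis_ad_lower_triangular (A : LieSubalgebra ℂ g) [IsSolvable A] :
    ∃ (n : ℕ) (B : Module.Basis (Fin n) ℂ g), ∀ x ∈ A, ∀ i j, i < j →
      LinearMap.toMatrix B B (ad ℂ g x) i j = 0 := by
  obtain ⟨B, hB⟩ := exists_basis_lower_triangular A _ g rfl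
  exact ⟨_, B, fun x hx => hB ⟨x, hx⟩⟩

lemma Matrix.charpoly_eq_prod_of_lower_triangular {n : ℕ} {M : Matrix (Fin n) (Fin n) ℂ}
    (hM : ∀ i j, i < j → M i j = 0) :
    M.charpoly = ∏ i, (Polynomial.X - Polynomial.C (M i i)) := by
  rw [← Matrix.charpoly_transpose, Matrix.charpoly_of_isUpperTriangular]
  · rfl
  · intro i j hij
    exact hM j i hij

lemma Matrix.mul_diag_of_lower_triangular {n : ℕ} {M N : Matrix (Fin n) (Fin n) ℂ}
    (hM : ∀ i j, i < j → M i j = 0) (hN : ∀ i j, i < j → N i j = 0) (i : Fin n) :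
    (M * N) i i = M i i * N i i := by
  rw [Matrix.mul_apply]
  refine Finset.sum_eq_single i (fun j _ hj => ?_) (by simp)
  rcases lt_or_gt_of_ne hj with h | h
  · rw [hN j i h, mul_zero]
  · rw [hM i j h, zero_mul]

lemma diag_eq_zero_of_isNilpotent {n : ℕ} (B : Module.Basis (Fin n) ℂ g) {φ : Module.End ℂ g}
    (hφ : ∀ i j, i < j → LinearMap.toMatrix B B φ i j = 0) (h : IsNilpotent φ) (i : Fin n) :
    LinearMap.toMatrix B B φ i i = 0 := by
  have h1 := (LinearMap.charpoly_eq_X_pow_iff φ).2 (fun m => by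
    obtain ⟨k, hk⟩ := h
    exact ⟨k, by rw [hk]; rfl⟩)
  rw [← LinearMap.charpoly_toMatrix φ B, Matrix.charpoly_eq_prod_of_lower_triangular hφ] at h1
  have h2 := congrArg (Polynomial.eval (LinearMap.toMatrix B B φ i i)) h1
  rw [Polynomial.eval_prod, Finset.prod_eq_zero (Finset.mem_univ i) (by simp)] at h2
  simp only [Polynomial.eval_pow, Polynomial.eval_X] at h2
  exact eq_zero_of_pow_eq_zero h2.symm

lemma killingForm_eq_zero_of_isNilpotent_of_isSolvable (A : LieSubalgebra ℂ g) [IsSolvable A]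
    {x y : g} (hx : x ∈ A) (hy : y ∈ A) (h : IsNilpotent (ad ℂ g x)) :
    killingForm ℂ g x y = 0 := by
  obtain ⟨n, B, hB⟩ := exists_basis_ad_lower_triangular A
  rw [killingForm_apply_apply, LinearMap.trace_eq_matrix_trace ℂ B,
    ← Module.End.mul_eq_comp, LinearMap.toMatrix_mul]
  refine Finset.sum_eq_zero fun i _ => ?_
  rw [Matrix.diag_apply, Matrix.mul_diag_of_lower_triangular (hB x hx) (hB y hy),
    diag_eq_zero_of_isNilpotent B (hB x hx) h, zero_mul]

lemma isNilpotent_ad_of_mem_derived (A : LieSubalgebra ℂ g) [IsSolvable A]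
    {z : g} (hz : z ∈ A.derived) : IsNilpotent (ad ℂ g z) := by
  obtain ⟨n, B, hB⟩ := exists_basis_ad_lower_triangular A
  have hl := hB _ (A.derived_le hz)
  have h0 : ∀ i, LinearMap.toMatrix B B (ad ℂ g z) i i = 0 := by
    intro i
    let F : g →ₗ[ℂ] ℂ :=
      { toFun := fun x => LinearMap.toMatrix B B (ad ℂ g x) i i
        map_add' := fun x y => by rw [map_add, map_add, Matrix.add_apply]
        map_smul' := fun t x => by rw [map_smul, map_smul, Matrix.smul_apply]; rfl }
    change F z = 0
    rw [← LinearMap.mem_ker]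
    refine LieSubalgebra.derived_induction (S := LinearMap.ker F) (fun x hx y hy => ?_) hz
    have hc : ad ℂ g ⁅x, y⁆ = ad ℂ g x * ad ℂ g y - ad ℂ g y * ad ℂ g x := by
      ext z
      exact lie_lie x y z
    change LinearMap.toMatrix B B (ad ℂ g ⁅x, y⁆) i i = 0
    rw [hc, map_sub, LinearMap.toMatrix_mul, LinearMap.toMatrix_mul,
      Matrix.sub_apply, Matrix.mul_diag_of_lower_triangular (hB x hx) (hB y hy),
      Matrix.mul_diag_of_lower_triangular (hB y hy) (hB x hx), mul_comm, sub_self]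
  have h1 : (ad ℂ g z).charpoly = Polynomial.X ^ n := by
    rw [← LinearMap.charpoly_toMatrix _ B, Matrix.charpoly_eq_prod_of_lower_triangular hl,
      Finset.prod_congr rfl fun i _ => by rw [h0 i, map_zero, sub_zero]]
    simp
  refine ⟨n, ?_⟩
  have h2 := LinearMap.aeval_self_charpoly (ad ℂ g z)
  rwa [h1, map_pow, Polynomial.aeval_X] at h2

lemma charpoly_ad_add_of_isNilpotent_of_isSolvable (A : LieSubalgebra ℂ g) [IsSolvable A]
    {x y : g} (hx : x ∈ A) (hy : y ∈ A) (h : IsNilpotent (ad ℂ g y)) :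
    (ad ℂ g (x + y)).charpoly = (ad ℂ g x).charpoly := by
  obtain ⟨n, B, hB⟩ := exists_basis_ad_lower_triangular A
  rw [← LinearMap.charpoly_toMatrix _ B, ← LinearMap.charpoly_toMatrix _ B,
    Matrix.charpoly_eq_prod_of_lower_triangular (hB _ (add_mem hx hy)),
    Matrix.charpoly_eq_prod_of_lower_triangular (hB _ hx)]
  refine Finset.prod_congr rfl fun i _ => ?_
  rw [map_add, map_add, Matrix.add_apply, diag_eq_zero_of_isNilpotent B (hB y hy) h, add_zero]

end Triangular

section Cartan

open LieAlgebra

variable {g : Type*} [LieRing g] [LieAlgebra ℂ g] [FiniteDimensional ℂ g]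

/-- A subalgebra on which the Killing form of the ambient algebra vanishes is solvable. -/
lemma LieSubalgebra.isSolvable_of_killingForm_eq_zero [IsKilling ℂ g] (A : LieSubalgebra ℂ g)
    (h : ∀ x ∈ A, ∀ y ∈ A, killingForm ℂ g x y = 0) : IsSolvable A := by
  have h1 : LieModule.traceForm ℂ A g = 0 := by
    ext x y
    exact h x x.2 y y.2
  have h2 := LieModule.isNilpotent_derivedSeries_of_traceForm_eq_zero h1
  apply isSolvable_of_isSolvable_derivedSeries_one
  have h3 : LieRing.IsNilpotent (derivedSeries ℂ A 1) := by
    rw [LieAlgebra.isNilpotent_iff_forall (R := ℂ)]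
    rintro ⟨x, hx⟩
    have h4 : IsNilpotent (ad ℂ g x) :=
      (LieModule.isNilpotent_iff_forall' (R := ℂ)).mp h2 ⟨x, hx⟩
    have h5 : IsNilpotent (ad ℂ A x) := LieSubalgebra.isNilpotent_ad_of_isNilpotent_ad A h4
    exact LieSubalgebra.isNilpotent_ad_of_isNilpotent_ad (derivedSeries ℂ A 1 : LieSubalgebra ℂ A)
      (x := ⟨x, hx⟩) h5
  infer_instance

lemma LieSubalgebra.isSolvable_iff_killingForm [IsKilling ℂ g] (A : LieSubalgebra ℂ g) :
    IsSolvable A ↔ ∀ x ∈ A, ∀ y ∈ A, ∀ z ∈ A, killingForm ℂ g ⁅x, y⁆ z = 0 := by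
  constructor
  · intro _ x hx y hy z hz
    exact killingForm_eq_zero_of_isNilpotent_of_isSolvable A (A.lie_mem hx hy) hz
      (isNilpotent_ad_of_mem_derived A (LieSubalgebra.lie_mem_derived hx hy))
  · intro h
    apply LieSubalgebra.isSolvable_of_derived
    apply LieSubalgebra.isSolvable_of_killingForm_eq_zero
    intro x hx y hy
    have hy' := A.derived_le hy
    exact LieSubalgebra.derived_induction (S := LinearMap.ker ((killingForm ℂ g).flip y))
      (fun a ha b hb => h a ha b hb y hy') hx

end Cartan

section MaximalSolvable

open LieAlgebra

variable {g : Type*} [LieRing g] [LieAlgebra ℂ g]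

lemma killingForm_comm (x y : g) : killingForm ℂ g x y = killingForm ℂ g y x :=
  LieModule.traceForm_comm ℂ g g x y

lemma killingForm_lie_left (x y z : g) :
    killingForm ℂ g ⁅x, y⁆ z = killingForm ℂ g x ⁅y, z⁆ :=
  LieModule.traceForm_apply_lie_apply ℂ g g x y z

/-- The orthogonal complement with respect to the Killing form. -/
noncomputable def killingPerp (S : Submodule ℂ g) : Submodule ℂ g :=
  LinearMap.BilinForm.orthogonal (killingForm ℂ g) S

lemma mem_killingPerp {S : Submodule ℂ g} {x : g} :
    x ∈ killingPerp S ↔ ∀ y ∈ S, killingForm ℂ g x y = 0 := by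
  simp only [killingPerp, LinearMap.BilinForm.mem_orthogonal_iff, killingForm_comm x]

variable [FiniteDimensional ℂ g]

lemma killingPerp_killingPerp [IsKilling ℂ g] (S : Submodule ℂ g) :
    killingPerp (killingPerp S) = S :=
  LinearMap.BilinForm.orthogonal_orthogonal (IsKilling.killingForm_nondegenerate ℂ g)
    (LieModule.traceForm_isSymm ℂ g g).isRefl S

lemma eq_zero_of_killingForm [IsKilling ℂ g] {x : g} (h : ∀ y, killingForm ℂ g x y = 0) :
    x = 0 := by
  have h1 : x ∈ killingPerp (⊤ : Submodule ℂ g) := mem_killingPerp.2 fun y _ => h y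
  have h2 : (⊤ : Submodule ℂ g) = killingPerp ⊥ := by
    rw [eq_comm, eq_top_iff]
    intro y _
    rw [mem_killingPerp]
    rintro _ rfl
    exact map_zero _
  rw [h2, killingPerp_killingPerp] at h1
  exact h1

lemma exists_le_maximal_isSolvable (A : LieSubalgebra ℂ g) (hA : IsSolvable A) :
    ∃ b : LieSubalgebra ℂ g, A ≤ b ∧ Maximal (fun B : LieSubalgebra ℂ g => IsSolvable B) b := by
  exact exists_maximal_ge_of_wellFoundedGT (fun B : LieSubalgebra ℂ g => IsSolvable B) A hA

lemma mem_killingPerp_of_isNilpotent_ad {b : LieSubalgebra ℂ g} (hb : IsSolvable b) {x : g}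
    (hx : x ∈ b) (h : IsNilpotent (ad ℂ g x)) : x ∈ killingPerp b.toSubmodule :=
  mem_killingPerp.2 fun _ hy => killingForm_eq_zero_of_isNilpotent_of_isSolvable b hx hy h

variable [IsKilling ℂ g] {b : LieSubalgebra ℂ g}

lemma mem_of_maximal_isSolvable (hb : Maximal (fun B : LieSubalgebra ℂ g => IsSolvable B) b)
    {z : g} (hz : ∀ x ∈ b, ∀ y ∈ b, killingForm ℂ g ⁅x, y⁆ z = 0) : z ∈ b := by
  by_contra hzb
  have hsol : IsSolvable b := hb.1
  have hK := (b.isSolvable_iff_killingForm).1 hb.1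
  let V : LieSubmodule ℂ b g :=
    { carrier := {z | ∀ x ∈ b, ∀ y ∈ b, killingForm ℂ g ⁅x, y⁆ z = 0}
      add_mem' := fun {u v} hu hv x hx y hy => by rw [map_add, hu x hx y hy, hv x hx y hy, add_zero]
      zero_mem' := fun x _ y _ => map_zero _
      smul_mem' := fun t u hu x hx y hy => by rw [map_smul, hu x hx y hy, smul_zero]
      lie_mem := fun {w u} hu x hx y hy => by
        change killingForm ℂ g ⁅x, y⁆ ⁅(w : g), u⁆ = 0
        rw [← killingForm_lie_left]
        exact hu _ (b.lie_mem hx hy) _ w.2 }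
  have hV : ∀ u, u ∈ V ↔ ∀ x ∈ b, ∀ y ∈ b, killingForm ℂ g ⁅x, y⁆ u = 0 := fun _ => Iff.rfl
  let N : LieSubmodule ℂ b g := b.toLieSubmodule
  let Q : LieSubmodule ℂ b (g ⧸ N) := V.map (LieSubmodule.Quotient.mk' N)
  have hzQ : LieSubmodule.Quotient.mk' N z ∈ Q := LieSubmodule.mem_map_of_mem hz
  have : Nontrivial Q := by
    refine ⟨⟨_, hzQ⟩, 0, fun h => hzb ?_⟩
    have h1 := congrArg Subtype.val h
    have h2 : LieSubmodule.Quotient.mk' N z = 0 := h1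
    rw [LieSubmodule.Quotient.mk_eq_zero] at h2
    exact h2
  obtain ⟨χ, hχ⟩ := LieModule.exists_nontrivial_weightSpace_of_isSolvable ℂ b Q
  obtain ⟨⟨⟨q, hq⟩, hw⟩, hq0⟩ := exists_ne (0 : LieModule.weightSpace Q χ)
  rw [LieModule.mem_weightSpace] at hw
  obtain ⟨v, hv, rfl⟩ := hq
  have hvb : v ∉ b := by
    intro h
    apply hq0
    apply Subtype.ext
    apply Subtype.ext
    change LieSubmodule.Quotient.mk' N v = 0
    rw [LieSubmodule.Quotient.mk_eq_zero]
    exact h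
  have hlie : ∀ x (hx : x ∈ b), ⁅x, v⁆ - χ ⟨x, hx⟩ • v ∈ b := by
    intro x hx
    have h1 : LieSubmodule.Quotient.mk' N ⁅(⟨x, hx⟩ : b), v⁆ =
      LieSubmodule.Quotient.mk' N (χ ⟨x, hx⟩ • v) := congrArg Subtype.val (hw ⟨x, hx⟩)
    rw [← sub_eq_zero, ← map_sub, LieSubmodule.Quotient.mk_eq_zero] at h1
    exact h1
  have hlie' : ∀ x ∈ b, ∃ t : ℂ, ∃ a ∈ b, ⁅x, v⁆ = a + t • v := fun x hx =>
    ⟨χ ⟨x, hx⟩, _, hlie x hx, by abel⟩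
  have hmem : ∀ u, u ∈ b.toSubmodule ⊔ Submodule.span ℂ {v} ↔ ∃ a ∈ b, ∃ t : ℂ, u = a + t • v := by
    intro u
    simp only [Submodule.mem_sup, Submodule.mem_span_singleton]
    constructor
    · rintro ⟨a, ha, _, ⟨t, rfl⟩, rfl⟩
      exact ⟨a, ha, t, rfl⟩
    · rintro ⟨a, ha, t, rfl⟩
      exact ⟨a, ha, _, ⟨t, rfl⟩, rfl⟩
  let A : LieSubalgebra ℂ g :=
    { b.toSubmodule ⊔ Submodule.span ℂ {v} with
      lie_mem' := by
        intro x y hx hy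
        change x ∈ b.toSubmodule ⊔ Submodule.span ℂ {v} at hx
        change y ∈ b.toSubmodule ⊔ Submodule.span ℂ {v} at hy
        change _ ∈ b.toSubmodule ⊔ Submodule.span ℂ {v}
        rw [hmem] at hx hy ⊢
        obtain ⟨a, ha, t, rfl⟩ := hx
        obtain ⟨a', ha', t', rfl⟩ := hy
        obtain ⟨s, d, hd, h1⟩ := hlie' a ha
        obtain ⟨s', d', hd', h1'⟩ := hlie' a' ha'
        refine ⟨⁅a, a'⁆ + t' • d - t • d', ?_, t' * s - t * s', ?_⟩
        · exact sub_mem (add_mem (b.lie_mem ha ha') (b.smul_mem _ hd)) (b.smul_mem _ hd')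
        · simp only [lie_add, add_lie, lie_smul, smul_lie, h1, ← lie_skew v a', h1', lie_self]
          module }
  have hA : ∀ u, u ∈ A ↔ ∃ a ∈ b, ∃ t : ℂ, u = a + t • v := hmem
  have hsolA : IsSolvable A := by
    rw [A.isSolvable_iff_killingForm]
    intro x hx y hy z hz
    rw [hA] at hx hy hz
    obtain ⟨x, hx, s, rfl⟩ := hx
    obtain ⟨y, hy, t, rfl⟩ := hy
    obtain ⟨z, hz, u, rfl⟩ := hz
    have h1 : ∀ a, killingForm ℂ g ⁅a, v⁆ v = 0 := fun a => by
      rw [killingForm_lie_left, lie_self, map_zero]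
    have h2 : ∀ a ∈ b, ∀ a' ∈ b, killingForm ℂ g ⁅a, v⁆ a' = 0 := fun a ha a' ha' => by
      rw [← lie_skew, map_neg, LinearMap.neg_apply, killingForm_lie_left, killingForm_comm,
        (hV v).1 hv a ha a' ha', neg_zero]
    simp only [lie_add, add_lie, lie_smul, smul_lie, ← lie_skew v y, lie_self, map_add, map_smul,
      map_neg, LinearMap.add_apply, LinearMap.smul_apply, LinearMap.neg_apply, h1, h2 x hx z hz,
      h2 y hy z hz, (hV v).1 hv x hx y hy, hK x hx y hy z hz]
    simp
  have hbA : b ≤ A := fun a ha => (hA a).2 ⟨a, ha, 0, by simp⟩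
  exact hvb (hb.2 hsolA hbA ((hA v).2 ⟨0, b.zero_mem, 1, by simp⟩))

lemma lie_mem_killingPerp_of_isSolvable (hb : IsSolvable b) {x y : g} (hx : x ∈ b) (hy : y ∈ b) :
    ⁅x, y⁆ ∈ killingPerp b.toSubmodule :=
  mem_killingPerp.2 fun z hz => (b.isSolvable_iff_killingForm).1 hb x hx y hy z hz

lemma killingPerp_le_of_maximal (hb : Maximal (fun B : LieSubalgebra ℂ g => IsSolvable B) b) :
    killingPerp b.toSubmodule ≤ b.toSubmodule := fun z hz =>
  mem_of_maximal_isSolvable hb fun x hx y hy => by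
    rw [killingForm_comm]
    exact mem_killingPerp.1 hz _ (b.lie_mem hx hy)

lemma killingPerp_eq_derived_of_maximal
    (hb : Maximal (fun B : LieSubalgebra ℂ g => IsSolvable B) b) :
    killingPerp b.toSubmodule = b.derived.toSubmodule := by
  have : b.toSubmodule = killingPerp b.derived.toSubmodule := by
    apply le_antisymm
    · intro x hx
      rw [mem_killingPerp]
      intro y hy
      exact LieSubalgebra.derived_induction (S := LinearMap.ker (killingForm ℂ g x))
        (fun a ha a' ha' => by
          rw [LinearMap.mem_ker, killingForm_comm]
          exact mem_killingPerp.1 (lie_mem_killingPerp_of_isSolvable hb.1 ha ha') _ hx) hy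
    · intro z hz
      refine mem_of_maximal_isSolvable hb fun x hx y hy => ?_
      rw [killingForm_comm]
      exact mem_killingPerp.1 hz _ (LieSubalgebra.lie_mem_derived hx hy)
  rw [this, killingPerp_killingPerp]

lemma isNilpotent_ad_of_mem_killingPerp
    (hb : Maximal (fun B : LieSubalgebra ℂ g => IsSolvable B) b) {x : g}
    (hx : x ∈ killingPerp b.toSubmodule) : IsNilpotent (ad ℂ g x) := by
  have : IsSolvable b := hb.1
  rw [killingPerp_eq_derived_of_maximal hb] at hx
  exact isNilpotent_ad_of_mem_derived b hx

lemma le_inf_sup_killingPerp_of_maximal {b' : LieSubalgebra ℂ g}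
    (hb : Maximal (fun B : LieSubalgebra ℂ g => IsSolvable B) b)
    (hb' : Maximal (fun B : LieSubalgebra ℂ g => IsSolvable B) b') :
    b'.toSubmodule ≤ (b.toSubmodule ⊓ b'.toSubmodule) ⊔ killingPerp b'.toSubmodule := by
  set c := killingPerp b.toSubmodule with hc
  set c' := killingPerp b'.toSubmodule with hc'
  have perp_sup : ∀ S T : Submodule ℂ g, killingPerp (S ⊔ T) = killingPerp S ⊓ killingPerp T := by
    intro S T
    ext x
    simp only [Submodule.mem_inf, mem_killingPerp]
    constructor
    · exact fun h => ⟨fun y hy => h y (Submodule.mem_sup_left hy),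
        fun y hy => h y (Submodule.mem_sup_right hy)⟩
    · rintro ⟨h1, h2⟩ y hy
      obtain ⟨s, hs, t, ht, rfl⟩ := Submodule.mem_sup.1 hy
      rw [map_add, h1 s hs, h2 t ht, add_zero]
  have h1 : killingPerp (b.toSubmodule ⊓ b'.toSubmodule) = c ⊔ c' := by
    rw [← killingPerp_killingPerp (c ⊔ c'), perp_sup, hc, hc', killingPerp_killingPerp,
      killingPerp_killingPerp]
  have h2 : killingPerp ((b.toSubmodule ⊓ b'.toSubmodule) ⊔ c') ≤ c' := by
    rw [perp_sup, h1, hc', killingPerp_killingPerp, ← hc']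
    rintro x ⟨hx, hxb⟩
    obtain ⟨u, hu, v, hv, rfl⟩ := Submodule.mem_sup.1 hx
    have hvb : v ∈ b'.toSubmodule := killingPerp_le_of_maximal hb' hv
    have hub : u ∈ b' := by
      have := sub_mem hxb hvb
      rwa [add_sub_cancel_right] at this
    exact add_mem (mem_killingPerp_of_isNilpotent_ad hb'.1 hub
      (isNilpotent_ad_of_mem_killingPerp hb hu)) hv
  intro x hx
  rw [← killingPerp_killingPerp ((b.toSubmodule ⊓ b'.toSubmodule) ⊔ c'), mem_killingPerp]
  intro y hy
  rw [killingForm_comm]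
  exact mem_killingPerp.1 (h2 hy) x hx

end MaximalSolvable

section MaximalSolvable

open LieAlgebra

variable {g : Type*} [LieRing g] [LieAlgebra ℂ g] [FiniteDimensional ℂ g]

lemma exists_add_lie_of_mem {b : LieSubalgebra ℂ g} {y : g} (hy : y ∈ b) {x : g} (hx : x ∈ b) :
    ∃ u ∈ b, u ∈ LieSubalgebra.engel ℂ y ∧ ∃ w ∈ b, x = u + ⁅y, w⁆ := by
  let φ : Module.End ℂ b := ad ℂ b ⟨y, hy⟩
  obtain ⟨n, hn⟩ := Filter.eventually_atTop.1 φ.eventually_isCompl_ker_pow_range_pow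
  have hc := hn (n + 1) (Nat.le_succ n)
  have hx' : (⟨x, hx⟩ : b) ∈ LinearMap.ker (φ ^ (n + 1)) ⊔ LinearMap.range (φ ^ (n + 1)) := by
    rw [hc.sup_eq_top]; trivial
  obtain ⟨u, hu, _, ⟨w, rfl⟩, h⟩ := Submodule.mem_sup.1 hx'
  refine ⟨u, u.2, ?_, ((φ ^ n) w : b), Subtype.property _, ?_⟩
  · rw [LieSubalgebra.mem_engel_iff]
    refine ⟨n + 1, ?_⟩
    have h1 : ∀ k (v : b), (((φ ^ k) v : b) : g) = (ad ℂ g y ^ k) v := by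
      intro k v
      induction k with
      | zero => rfl
      | succ k ih =>
        rw [pow_succ', pow_succ', Module.End.mul_apply, Module.End.mul_apply, ← ih]
        rfl
    rw [← h1, LinearMap.mem_ker.1 hu]
    rfl
  · rw [pow_succ', Module.End.mul_apply] at h
    exact (congrArg Subtype.val h).symm

variable [IsKilling ℂ g] {b : LieSubalgebra ℂ g}

lemma exists_isRegular_mem_of_maximal
    (hb : Maximal (fun B : LieSubalgebra ℂ g => IsSolvable B) b) :
    ∃ y ∈ b, IsRegular ℂ y := by
  obtain ⟨y, hy⟩ := LieAlgebra.exists_isRegular ℂ g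
  have := isCartanSubalgebra_engel_of_isRegular hy
  have hsol : IsSolvable (LieSubalgebra.engel ℂ y) := inferInstance
  obtain ⟨b', hle, hb'⟩ := exists_le_maximal_isSolvable (LieSubalgebra.engel ℂ y) hsol
  have hyb' : y ∈ b' := hle (LieSubalgebra.self_mem_engel ℂ y)
  obtain ⟨u, hu, n, hn, h⟩ := Submodule.mem_sup.1 (le_inf_sup_killingPerp_of_maximal hb hb' hyb')
  refine ⟨u, hu.1, ?_⟩
  have : IsSolvable b' := hb'.1
  rw [isRegular_congr_charpoly (y := y)]
  · exact hy
  · rw [← h]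
    exact (charpoly_ad_add_of_isNilpotent_of_isSolvable b' hu.2 (killingPerp_le_of_maximal hb' hn)
      (isNilpotent_ad_of_mem_killingPerp hb' hn)).symm

lemma engel_inf_killingPerp_of_maximal
    (hb : Maximal (fun B : LieSubalgebra ℂ g => IsSolvable B) b) {y : g} (hy : IsRegular ℂ y)
    {z : g} (hz : z ∈ LieSubalgebra.engel ℂ y) (hz' : z ∈ killingPerp b.toSubmodule) : z = 0 :=
  have := isCartanSubalgebra_engel_of_isRegular hy
  LieAlgebra.IsKilling.eq_zero_of_isNilpotent_ad_of_mem_isCartanSubalgebra ℂ g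
    (LieSubalgebra.engel ℂ y) hz (isNilpotent_ad_of_mem_killingPerp hb hz')

lemma lie_eq_zero_of_mem_engel {y : g} (hy : IsRegular ℂ y) {z w : g}
    (hz : z ∈ LieSubalgebra.engel ℂ y) (hw : w ∈ LieSubalgebra.engel ℂ y) : ⁅z, w⁆ = 0 := by
  have := isCartanSubalgebra_engel_of_isRegular hy
  exact congrArg Subtype.val (trivial_lie_zero (LieSubalgebra.engel ℂ y)
    (LieSubalgebra.engel ℂ y) ⟨z, hz⟩ ⟨w, hw⟩)

lemma engel_le_of_maximal
    (hb : Maximal (fun B : LieSubalgebra ℂ g => IsSolvable B) b) {y : g} (hy : IsRegular ℂ y)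
    (hyb : y ∈ b) : LieSubalgebra.engel ℂ y ≤ b := by
  set t := LieSubalgebra.engel ℂ y with ht
  let S : Submodule ℂ g := b.toSubmodule ⊓ t.toSubmodule
  let F : t →ₗ[ℂ] Module.Dual ℂ S :=
    (LinearMap.lcomp ℂ ℂ S.subtype) ∘ₗ (killingForm ℂ g) ∘ₗ t.toSubmodule.subtype
  have hF : Function.Injective F := by
    rw [← LinearMap.ker_eq_bot, LinearMap.ker_eq_bot']
    rintro ⟨z, hz⟩ h
    have h1 : ∀ s ∈ b, s ∈ t → killingForm ℂ g z s = 0 := fun s hs hs' =>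
      LinearMap.congr_fun h ⟨s, hs, hs'⟩
    apply Subtype.ext
    refine engel_inf_killingPerp_of_maximal hb hy hz (mem_killingPerp.2 fun x hx => ?_)
    obtain ⟨u, hub, hut, w, hw, rfl⟩ := exists_add_lie_of_mem hyb hx
    rw [map_add, h1 u hub hut, ← killingForm_lie_left,
      lie_eq_zero_of_mem_engel hy hz (LieSubalgebra.self_mem_engel ℂ y)]
    simp
  have h1 := LinearMap.finrank_le_finrank_of_injective hF
  rw [Subspace.dual_finrank_eq] at h1
  have h2 : S = t.toSubmodule := Submodule.eq_of_le_of_finrank_le inf_le_right h1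
  intro z hz
  have : z ∈ S := by rw [h2]; exact hz
  exact this.1

lemma le_engel_sup_killingPerp_of_maximal
    (hb : Maximal (fun B : LieSubalgebra ℂ g => IsSolvable B) b) {y : g}
    (hyb : y ∈ b) : b.toSubmodule ≤
      (LieSubalgebra.engel ℂ y).toSubmodule ⊔ killingPerp b.toSubmodule := by
  intro x hx
  obtain ⟨u, hub, hut, w, hw, rfl⟩ := exists_add_lie_of_mem hyb hx
  exact Submodule.mem_sup.2 ⟨u, hut, _, lie_mem_killingPerp_of_isSolvable hb.1 hyb hw, rfl⟩

end MaximalSolvable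

section SpectralSubspace

open Module

variable {V : Type*} [AddCommGroup V] [Module ℂ V]

/-- The sum of the generalized eigenspaces of `f` for the eigenvalues in `s`. -/
noncomputable def spectralSubspace (f : End ℂ V) (s : Set ℂ) : Submodule ℂ V :=
  ⨆ c ∈ s, f.maxGenEigenspace c

lemma maxGenEigenspace_le_spectralSubspace (f : End ℂ V) {s : Set ℂ} {c : ℂ} (hc : c ∈ s) :
    f.maxGenEigenspace c ≤ spectralSubspace f s :=
  le_iSup₂_of_le c hc le_rfl

lemma spectralSubspace_le {f : End ℂ V} {s : Set ℂ} {S : Submodule ℂ V}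
    (h : ∀ c ∈ s, ∀ x ∈ f.maxGenEigenspace c, x ∈ S) : spectralSubspace f s ≤ S :=
  iSup₂_le fun c hc x hx => h c hc x hx

lemma spectralSubspace_mono (f : End ℂ V) {s t : Set ℂ} (h : s ⊆ t) :
    spectralSubspace f s ≤ spectralSubspace f t :=
  spectralSubspace_le fun _ hc _ hx => maxGenEigenspace_le_spectralSubspace f (h hc) hx

lemma apply_mem_maxGenEigenspace (f : End ℂ V) {c : ℂ} {x : V}
    (hx : x ∈ f.maxGenEigenspace c) : f x ∈ f.maxGenEigenspace c :=
  End.mapsTo_maxGenEigenspace_of_comm (Commute.refl f) c hx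

lemma apply_mem_spectralSubspace (f : End ℂ V) {s : Set ℂ} {x : V}
    (hx : x ∈ spectralSubspace f s) : f x ∈ spectralSubspace f s := by
  have : spectralSubspace f s ≤ (spectralSubspace f s).comap f :=
    spectralSubspace_le fun c hc y hy =>
      maxGenEigenspace_le_spectralSubspace f hc (apply_mem_maxGenEigenspace f hy)
  exact this hx

lemma maxGenEigenspace_induction {f : End ℂ V} {c : ℂ} {p : V → Prop} (h0 : p 0)
    (hs : ∀ x ∈ f.maxGenEigenspace c, p (f x - c • x) → p x) :
    ∀ x ∈ f.maxGenEigenspace c, p x := by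
  have key : ∀ n : ℕ, ∀ x, ((f - c • (1 : End ℂ V)) ^ n) x = 0 → p x := by
    intro n
    induction n with
    | zero => intro x hx; simp only [pow_zero, End.one_apply] at hx; rwa [hx]
    | succ n ih =>
      intro x hx
      refine hs x ((End.mem_maxGenEigenspace _ _ _).2 ⟨n + 1, hx⟩) (ih _ ?_)
      rw [pow_succ] at hx
      simpa using hx
  intro x hx
  obtain ⟨n, hn⟩ := (End.mem_maxGenEigenspace _ _ _).1 hx
  exact key n x hn

lemma mem_maxGenEigenspace_of_sub_mem {f : End ℂ V} {c : ℂ} {x : V}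
    (h : f x - c • x ∈ f.maxGenEigenspace c) : x ∈ f.maxGenEigenspace c := by
  obtain ⟨n, hn⟩ := (End.mem_maxGenEigenspace _ _ _).1 h
  refine (End.mem_maxGenEigenspace _ _ _).2 ⟨n + 1, ?_⟩
  rw [pow_succ]
  simpa using hn

variable [FiniteDimensional ℂ V]

lemma iSup_inf_maxGenEigenspace (f : End ℂ V) {A : Submodule ℂ V} (hA : ∀ x ∈ A, f x ∈ A) :
    A = ⨆ c, A ⊓ f.maxGenEigenspace c :=
  Submodule.eq_iSup_inf_genEigenspace ⊤ hA (End.iSup_maxGenEigenspace_eq_top f)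

lemma spectralSubspace_univ (f : End ℂ V) : spectralSubspace f Set.univ = ⊤ := by
  simpa [spectralSubspace] using End.iSup_maxGenEigenspace_eq_top f

lemma isCompl_spectralSubspace (f : End ℂ V) (s : Set ℂ) :
    IsCompl (spectralSubspace f s) (spectralSubspace f sᶜ) := by
  constructor
  · have h : iSupIndep (f.maxGenEigenspace) := End.independent_maxGenEigenspace f
    exact h.disjoint_biSup_biSup (disjoint_compl_right (a := s))
  · rw [codisjoint_iff, eq_top_iff, ← spectralSubspace_univ f]
    refine spectralSubspace_le fun c _ x hx => ?_
    by_cases hc : c ∈ s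
    · exact Submodule.mem_sup_left (maxGenEigenspace_le_spectralSubspace f hc hx)
    · exact Submodule.mem_sup_right (maxGenEigenspace_le_spectralSubspace f hc hx)

lemma exists_spectralProjection (f : End ℂ V) (s : Set ℂ) :
    ∃ π : End ℂ V, (∀ x ∈ spectralSubspace f s, π x = x) ∧
      (∀ x ∈ spectralSubspace f sᶜ, π x = 0) ∧ (∀ x, π x ∈ spectralSubspace f s) ∧
      ∀ x, π (f x) = f (π x) := by
  have hc := isCompl_spectralSubspace f s
  refine ⟨Submodule.projection _ _ hc, fun x hx => Submodule.projection_apply_left hc ⟨x, hx⟩,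
    fun x hx => Submodule.projection_apply_of_mem_right hc hx, fun x => by simp, ?_⟩
  intro x
  obtain ⟨y, hy, z, hz, rfl⟩ := Submodule.mem_sup.1
    (show x ∈ spectralSubspace f s ⊔ spectralSubspace f sᶜ by rw [hc.sup_eq_top]; trivial)
  have h1 := fun u (hu : u ∈ spectralSubspace f s) =>
    Submodule.projection_apply_left hc ⟨u, hu⟩
  have h2 := fun u (hu : u ∈ spectralSubspace f sᶜ) => Submodule.projection_apply_of_mem_right hc hu
  simp only at h1
  rw [map_add, map_add, map_add, h1 y hy, h2 z hz, h1 _ (apply_mem_spectralSubspace f hy),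
    h2 _ (apply_mem_spectralSubspace f hz), add_zero, add_zero]

end SpectralSubspace

section SpectralBracket

open LieAlgebra Module

variable {g : Type*} [LieRing g] [LieAlgebra ℂ g]

/-- The modified Rota–Baxter identity of weight `-1`. -/
def IsRotaBaxter (f : End ℂ g) : Prop :=
  ∀ x y : g, ⁅f x, f y⁆ = f (⁅f x, y⁆ + ⁅x, f y⁆ - ⁅x, y⁆)

lemma IsRotaBaxter.one_sub {f : End ℂ g} (hf : IsRotaBaxter f) : IsRotaBaxter (1 - f) := by
  intro x y
  have h := hf x y
  simp only [LinearMap.sub_apply, End.one_apply, map_add, map_sub, sub_lie, lie_sub] at h ⊢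
  rw [h]
  abel

lemma IsRotaBaxter.lie_mem_of_maxGenEigenspace {f : End ℂ g} (hf : IsRotaBaxter f) {a b : ℂ}
    {S : Submodule ℂ g} (hS : ∀ v ∈ S, f v ∈ S)
    (h : ∀ v, (a + b - 1) • f v - (a * b) • v ∈ S → v ∈ S) :
    ∀ x ∈ f.maxGenEigenspace a, ∀ y ∈ f.maxGenEigenspace b, ⁅x, y⁆ ∈ S := by
  refine maxGenEigenspace_induction (p := fun x => ∀ y ∈ f.maxGenEigenspace b, ⁅x, y⁆ ∈ S) ?_ ?_
  · intro y _
    simp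
  · intro x _ hx
    refine maxGenEigenspace_induction (by simp) ?_
    intro y hy hxy
    apply h
    have e : (a + b - 1) • f ⁅x, y⁆ - (a * b) • ⁅x, y⁆
        = a • ⁅x, f y - b • y⁆ - f ⁅x, f y - b • y⁆ + (b • ⁅f x - a • x, y⁆ - f ⁅f x - a • x, y⁆)
          + ⁅f x - a • x, f y - b • y⁆ := by
      have h := hf x y
      simp only [map_add, map_sub] at h
      simp only [map_sub, sub_lie, lie_sub, smul_lie, lie_smul, map_smul, h]
      module
    rw [e]
    have h1 := hx _ hy
    have h2 := hx _ (Submodule.sub_mem _ (apply_mem_maxGenEigenspace f hy)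
      (Submodule.smul_mem _ b hy))
    exact S.add_mem (S.add_mem (S.sub_mem (S.smul_mem _ hxy) (hS _ hxy))
      (S.sub_mem (S.smul_mem _ h1) (hS _ h1))) h2

lemma IsRotaBaxter.lie_mem_maxGenEigenspace {f : End ℂ g} (hf : IsRotaBaxter f) {a b : ℂ}
    (hab : a + b - 1 ≠ 0) {x y : g} (hx : x ∈ f.maxGenEigenspace a)
    (hy : y ∈ f.maxGenEigenspace b) :
    ⁅x, y⁆ ∈ f.maxGenEigenspace (a * b / (a + b - 1)) := by
  refine hf.lie_mem_of_maxGenEigenspace (fun v hv => apply_mem_maxGenEigenspace f hv)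
    (fun v hv => mem_maxGenEigenspace_of_sub_mem ?_) x hx y hy
  convert Submodule.smul_mem _ (a + b - 1)⁻¹ hv using 1
  rw [smul_sub, smul_smul, smul_smul, inv_mul_cancel₀ hab, one_smul]
  congr 2
  field_simp

lemma IsRotaBaxter.lie_eq_zero_of_maxGenEigenspace {f : End ℂ g} (hf : IsRotaBaxter f) {a b : ℂ}
    (hab : a + b - 1 = 0) (h : a * b ≠ 0) {x y : g} (hx : x ∈ f.maxGenEigenspace a)
    (hy : y ∈ f.maxGenEigenspace b) : ⁅x, y⁆ = 0 := by
  rw [← Submodule.mem_bot ℂ]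
  refine hf.lie_mem_of_maxGenEigenspace (by simp) (fun v hv => ?_) x hx y hy
  rw [hab, zero_smul, zero_sub, Submodule.mem_bot, neg_eq_zero] at hv
  simpa using (smul_eq_zero.1 hv).resolve_left h

lemma killingForm_eq_zero_of_maxGenEigenspace {f : End ℂ g}
    (hK : ∀ x y, killingForm ℂ g (f x) y + killingForm ℂ g x (f y) = killingForm ℂ g x y)
    {a b : ℂ} (hab : a + b ≠ 1) :
    ∀ x ∈ f.maxGenEigenspace a, ∀ y ∈ f.maxGenEigenspace b, killingForm ℂ g x y = 0 := by
  refine maxGenEigenspace_induction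
    (p := fun x => ∀ y ∈ f.maxGenEigenspace b, killingForm ℂ g x y = 0) ?_ ?_
  · intro y _
    simp
  · intro x _ hx
    refine maxGenEigenspace_induction (by simp) ?_
    intro y hy hxy
    have h1 := hx _ hy
    have h := hK x y
    simp only [map_sub, map_smul, LinearMap.sub_apply, LinearMap.smul_apply, smul_eq_mul] at h1 hxy
    have : (a + b - 1) * killingForm ℂ g x y = 0 := by linear_combination h - h1 - hxy
    exact (mul_eq_zero.1 this).resolve_left (sub_ne_zero.2 hab)

lemma killingForm_eq_zero_of_spectralSubspace [FiniteDimensional ℂ g] {f : End ℂ g}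
    (hK : ∀ x y, killingForm ℂ g (f x) y + killingForm ℂ g x (f y) = killingForm ℂ g x y)
    {s t : Set ℂ} (hst : ∀ a ∈ s, ∀ b ∈ t, a + b ≠ 1) {x y : g} (hx : x ∈ spectralSubspace f s)
    (hy : y ∈ spectralSubspace f t) : killingForm ℂ g x y = 0 := by
  have h1 : spectralSubspace f s ≤ killingPerp (spectralSubspace f t) := by
    refine spectralSubspace_le fun a ha u hu => mem_killingPerp.2 fun v hv => ?_
    have h2 : spectralSubspace f t ≤ LinearMap.ker (killingForm ℂ g u) :=
      spectralSubspace_le fun b hb w hw =>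
        killingForm_eq_zero_of_maxGenEigenspace hK (hst a ha b hb) u hu w hw
    exact h2 hv
  exact mem_killingPerp.1 (h1 hx) y hy

/-- The image of two spectral subspaces under the bracket. -/
lemma IsRotaBaxter.lie_mem_spectralSubspace {f : End ℂ g} (hf : IsRotaBaxter f) {s t u : Set ℂ}
    (h0 : ∀ a ∈ s, ∀ b ∈ t, a + b - 1 = 0 → a * b ≠ 0)
    (h : ∀ a ∈ s, ∀ b ∈ t, a + b - 1 ≠ 0 → a * b / (a + b - 1) ∈ u) {x y : g}
    (hx : x ∈ spectralSubspace f s) (hy : y ∈ spectralSubspace f t) :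
    ⁅x, y⁆ ∈ spectralSubspace f u := by
  have h1 : spectralSubspace f t ≤ (spectralSubspace f u).comap (ad ℂ g x) := by
    refine spectralSubspace_le fun b hb w hw => ?_
    have h2 : spectralSubspace f s ≤ (spectralSubspace f u).comap (ad ℂ g w) := by
      refine spectralSubspace_le fun a ha v hv => ?_
      rw [Submodule.mem_comap, ad_apply, ← lie_skew]
      refine Submodule.neg_mem _ ?_
      by_cases hab : a + b - 1 = 0
      · rw [hf.lie_eq_zero_of_maxGenEigenspace hab (h0 a ha b hb hab) hv hw]
        exact Submodule.zero_mem _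
      · exact maxGenEigenspace_le_spectralSubspace f (h a ha b hb hab)
          (hf.lie_mem_maxGenEigenspace hab hv hw)
    have h3 := h2 hx
    rw [Submodule.mem_comap, ad_apply, ← lie_skew] at h3 ⊢
    exact (Submodule.neg_mem_iff _).1 (by simpa using h3)
  exact h1 hy

lemma add_sub_one_eq_zero_mul_ne_zero {a b : ℂ} (ha : a.re ≤ 1 / 2) (hb : b.re ≤ 1 / 2)
    (h : a + b - 1 = 0) : a * b ≠ 0 := by
  have := congrArg Complex.re h
  simp only [Complex.sub_re, Complex.add_re, Complex.one_re, Complex.zero_re] at this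
  refine mul_ne_zero ?_ ?_ <;>
  · rintro rfl
    simp only [Complex.zero_re] at *
    linarith

lemma one_sub_two_re_mul_div {a b : ℂ} (h : a + b - 1 ≠ 0) :
    (1 - 2 * (a * b / (a + b - 1)).re) * Complex.normSq (a + b - 1)
      = Complex.normSq (a - 1) * Complex.normSq (b - 1)
        - Complex.normSq a * Complex.normSq b := by
  have h1 : a * b / (a + b - 1) * (a + b - 1) = a * b := div_mul_cancel₀ _ h
  set c := a * b / (a + b - 1)
  have h2 : (c - 1) * (a + b - 1) = (a - 1) * (b - 1) := by linear_combination h1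
  have h3 := congrArg Complex.normSq h1
  have h4 := congrArg Complex.normSq h2
  rw [Complex.normSq_mul, Complex.normSq_mul] at h3 h4
  rw [← h3, ← h4, ← sub_mul]
  congr 1
  simp only [Complex.normSq_apply, Complex.sub_re, Complex.sub_im, Complex.one_re, Complex.one_im]
  ring

lemma re_mul_div_le {a b : ℂ} (ha : a.re ≤ 1 / 2) (hb : b.re ≤ 1 / 2) (h : a + b - 1 ≠ 0) :
    (a * b / (a + b - 1)).re ≤ 1 / 2 := by
  have h1 := one_sub_two_re_mul_div h
  have h2 : 0 < Complex.normSq (a + b - 1) := Complex.normSq_pos.2 h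
  have e (z : ℂ) : Complex.normSq (z - 1) = Complex.normSq z + (1 - 2 * z.re) := by
    simp only [Complex.normSq_apply, Complex.sub_re, Complex.sub_im, Complex.one_re, Complex.one_im]
    ring
  have h3 := Complex.normSq_nonneg a
  have h4 := Complex.normSq_nonneg b
  rw [e a, e b] at h1
  have h5 : 0 ≤ (1 - 2 * (a * b / (a + b - 1)).re) * Complex.normSq (a + b - 1) := by
    rw [h1]
    nlinarith
  nlinarith [nonneg_of_mul_nonneg_left h5 h2]

lemma re_mul_div_lt {a b : ℂ} (ha : a.re < 1 / 2) (hb : b.re ≤ 1 / 2) (h : a + b - 1 ≠ 0) :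
    (a * b / (a + b - 1)).re < 1 / 2 := by
  have h1 := one_sub_two_re_mul_div h
  have h2 : 0 < Complex.normSq (a + b - 1) := Complex.normSq_pos.2 h
  have e (z : ℂ) : Complex.normSq (z - 1) = Complex.normSq z + (1 - 2 * z.re) := by
    simp only [Complex.normSq_apply, Complex.sub_re, Complex.sub_im, Complex.one_re, Complex.one_im]
    ring
  have h3 := Complex.normSq_nonneg a
  have h4 : 0 < Complex.normSq (b - 1) := by
    refine Complex.normSq_pos.2 fun hb1 => ?_
    rw [sub_eq_zero.1 hb1] at hb
    norm_num at hb
  have h5 : 0 < (1 - 2 * (a * b / (a + b - 1)).re) * Complex.normSq (a + b - 1) := by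
    rw [h1, e a]
    have := e b
    nlinarith
  nlinarith [pos_of_mul_pos_left h5 h2.le]

end SpectralBracket

section SpectralSolvable

open LieAlgebra LieSubalgebra Module

variable {g : Type*} [LieRing g] [LieAlgebra ℂ g]

/-- The sum of the generalized eigenspaces of a Rota–Baxter operator for the eigenvalues of
real part at most `1 / 2`. -/
noncomputable def IsRotaBaxter.lower {f : End ℂ g} (hf : IsRotaBaxter f) : LieSubalgebra ℂ g where
  __ := spectralSubspace f {c | c.re ≤ 1 / 2}
  lie_mem' {_ _} hx hy := hf.lie_mem_spectralSubspace
    (fun _ ha _ hb hab => add_sub_one_eq_zero_mul_ne_zero ha hb hab)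
    (fun _ ha _ hb hab => re_mul_div_le ha hb hab) hx hy

/-- The sum of the generalized eigenspaces of a Rota–Baxter operator for the eigenvalues of
real part less than `1 / 2`. -/
noncomputable def IsRotaBaxter.strictLower {f : End ℂ g} (hf : IsRotaBaxter f) :
    LieSubalgebra ℂ g where
  __ := spectralSubspace f {c | c.re < 1 / 2}
  lie_mem' {_ _} hx hy := hf.lie_mem_spectralSubspace
    (fun _ ha _ hb hab => add_sub_one_eq_zero_mul_ne_zero (le_of_lt ha) (le_of_lt hb) hab)
    (fun _ ha _ hb hab => re_mul_div_lt ha (le_of_lt hb) hab) hx hy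

lemma lt_of_mul_div_eq {a c d : ℂ} (ha : a.re = 1 / 2) (hc : c.re = 1 / 2) (hd : d.re = 1 / 2)
    (h : a + c - 1 ≠ 0) (e : a * c / (a + c - 1) = d) (hcd : d.im ≤ c.im) :
    d.im < a.im ∧ d.im < c.im := by
  rw [div_eq_iff h] at e
  have h1 := congrArg Complex.re e
  simp only [Complex.mul_re, Complex.sub_re, Complex.add_re, Complex.one_re, Complex.sub_im,
    Complex.add_im, Complex.one_im, ha, hc, hd] at h1
  have h2 : (a.im - d.im) * (c.im - d.im) = d.im ^ 2 + 1 / 4 := by linear_combination -h1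
  have h3 : 0 < (a.im - d.im) * (c.im - d.im) := by rw [h2]; positivity
  have h4 := pos_of_mul_pos_left h3 (sub_nonneg.2 hcd)
  have h5 := pos_of_mul_pos_right h3 h4.le
  exact ⟨sub_pos.1 h4, sub_pos.1 h5⟩

variable [FiniteDimensional ℂ g]

lemma eq_zero_of_mem_spectralSubspace {f : End ℂ g} {s : Set ℂ} {c : ℂ} (hc : c ∉ s) {x : g}
    (hx : x ∈ spectralSubspace f s) (hxc : x ∈ f.maxGenEigenspace c) : x = 0 :=
  Submodule.disjoint_def.1 (isCompl_spectralSubspace f s).disjoint x hx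
    (maxGenEigenspace_le_spectralSubspace f hc hxc)

lemma exists_finset_im_mem (f : End ℂ g) :
    ∃ M : Finset ℝ, ∀ c : ℂ, ∀ x ∈ f.maxGenEigenspace c, x ≠ 0 → c.im ∈ M := by
  refine ⟨f.finite_hasEigenvalue.toFinset.image Complex.im, fun c x hx hx0 => ?_⟩
  refine Finset.mem_image_of_mem _ ((Set.Finite.mem_toFinset _).2 ?_)
  by_contra h
  refine hx0 ?_
  have : f.maxGenEigenspace c = ⊥ := by
    by_contra hne
    exact h (End.hasUnifEigenvalue_iff_hasUnifEigenvalue_one (k := ⊤) (by simp) |>.1 hne)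
  rw [this] at hx
  simpa using hx

lemma IsRotaBaxter.le_of_forall_mem {f : End ℂ g} (hf : IsRotaBaxter f) {A : LieSubalgebra ℂ g}
    (hA : ∀ x ∈ A, f x ∈ A) (hp : A ≤ hf.lower) (hperf : A.derived = A) {M : Finset ℝ}
    (hM : ∀ c : ℂ, ∀ x ∈ f.maxGenEigenspace c, x ≠ 0 → c.im ∈ M) (s : Finset ℝ) :
    (∀ j ∈ M, ∀ i ∈ s, j ≤ i → j ∈ s) → ∀ Y : LieSubalgebra ℂ g,
      (∀ c : ℂ, c.re < 1 / 2 ∨ c.im ∉ s → ∀ x ∈ A, x ∈ f.maxGenEigenspace c → x ∈ Y) → A ≤ Y := by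
  have hsum : ∀ S : Submodule ℂ g, (∀ c, ∀ x ∈ A, x ∈ f.maxGenEigenspace c → x ∈ S) →
      ∀ x ∈ A, x ∈ S := by
    intro S hS x hx
    have h1 : A.toSubmodule ≤ S := by
      rw [iSup_inf_maxGenEigenspace f (A := A.toSubmodule) hA]
      exact iSup_le fun c y hy => hS c y hy.1 hy.2
    exact h1 hx
  have hre : ∀ c, ∀ x ∈ A, x ∈ f.maxGenEigenspace c → x ≠ 0 → c.re ≤ 1 / 2 := by
    intro c x hx hxc hx0
    by_contra hc
    exact hx0 (eq_zero_of_mem_spectralSubspace (s := {c | c.re ≤ 1 / 2}) hc (hp hx) hxc)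
  induction s using Finset.induction_on_max with
  | empty =>
    intro _ Y hY x hx
    exact hsum Y.toSubmodule (fun c y hy hyc => hY c (by simp) y hy hyc) x hx
  | insert m s hs ih =>
    intro hinit Y hY
    have hinit' : ∀ j ∈ M, ∀ i ∈ s, j ≤ i → j ∈ s := by
      intro j hj i hi hji
      have := hinit j hj i (Finset.mem_insert_of_mem hi) hji
      rcases Finset.mem_insert.1 this with rfl | h
      · exact absurd (hs i hi) (not_lt.2 hji)
      · exact h
    replace ih := ih hinit'
    refine ih Y fun c hc x hx hxc => ?_
    by_cases hx0 : x = 0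
    · rw [hx0]; exact Y.zero_mem
    by_cases hlt : c.re < 1 / 2
    · exact hY c (Or.inl hlt) x hx hxc
    by_cases him : c.im ≠ m
    · exact hY c (Or.inr (by simpa [him] using hc.resolve_left hlt)) x hx hxc
    push Not at him
    have hcre : c.re = 1 / 2 := le_antisymm (hre c x hx hxc hx0) (not_lt.1 hlt)
    obtain ⟨π, h1, h2, -, -⟩ := exists_spectralProjection f {c}
    have hπ1 : ∀ v ∈ f.maxGenEigenspace c, π v = v := fun v hv =>
      h1 v (maxGenEigenspace_le_spectralSubspace f (Set.mem_singleton c) hv)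
    have hπ0 : ∀ a ≠ c, ∀ v ∈ f.maxGenEigenspace a, π v = 0 := fun a ha v hv =>
      h2 v (maxGenEigenspace_le_spectralSubspace f (by simpa using ha) hv)
    let W : LieSubalgebra ℂ g :=
      { carrier := {v | v ∈ A ∧ ∀ u ∈ A, π ⁅u, v⁆ ∈ Y}
        zero_mem' := ⟨A.zero_mem, fun u _ => by simp⟩
        add_mem' := fun {v w} hv hw => ⟨A.add_mem hv.1 hw.1, fun u hu => by
          rw [lie_add, map_add]; exact Y.add_mem (hv.2 u hu) (hw.2 u hu)⟩
        smul_mem' := fun k v hv => ⟨A.smul_mem k hv.1, fun u hu => by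
          rw [lie_smul, map_smul]; exact Y.smul_mem k (hv.2 u hu)⟩
        lie_mem' := fun {v w} hv hw => ⟨A.lie_mem hv.1 hw.1, fun u hu => by
          have e : ⁅u, ⁅v, w⁆⁆ = ⁅⁅u, v⁆, w⁆ - ⁅⁅u, w⁆, v⁆ := by
            rw [leibniz_lie u v w, ← lie_skew v ⁅u, w⁆]; abel
          rw [e, map_sub]
          exact Y.sub_mem (hw.2 _ (A.lie_mem hu hv.1)) (hv.2 _ (A.lie_mem hu hw.1))⟩ }
    have hW : A ≤ W := by
      refine ih W fun b hb v hv hvb => ⟨hv, ?_⟩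
      have h : ∀ u ∈ A, u ∈ Y.toSubmodule.comap (π ∘ₗ ((ad ℂ g v) : g →ₗ[ℂ] g)) := by
        refine hsum _ ?_
        intro a u hu hua
        change π ⁅v, u⁆ ∈ Y
        by_cases hv0 : v = 0
        · rw [hv0, zero_lie, map_zero]; exact Y.zero_mem
        by_cases hu0 : u = 0
        · rw [hu0, lie_zero, map_zero]; exact Y.zero_mem
        have hbre := hre b v hv hvb hv0
        have hare := hre a u hu hua hu0
        by_cases hab : b + a - 1 = 0
        · rw [hf.lie_eq_zero_of_maxGenEigenspace hab
            (add_sub_one_eq_zero_mul_ne_zero hbre hare hab) hvb hua, map_zero]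
          exact Y.zero_mem
        have hmem := hf.lie_mem_maxGenEigenspace hab hvb hua
        by_cases hne : b * a / (b + a - 1) = c
        · rw [hne] at hmem
          rw [hπ1 _ hmem]
          have hb2 : b.re = 1 / 2 := by
            refine le_antisymm hbre (not_lt.1 fun hlt' => ?_)
            exact hlt (hne ▸ re_mul_div_lt hlt' hare hab)
          have ha2 : a.re = 1 / 2 := by
            refine le_antisymm hare (not_lt.1 fun hlt' => ?_)
            refine hlt (hne ▸ ?_)
            rw [mul_comm, add_comm b a] at *
            exact re_mul_div_lt hlt' hbre hab
          have hbm : c.im ≤ b.im := by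
            rw [him]
            by_contra hlt'
            have h3 := hinit b.im (hM b v hvb hv0) m (Finset.mem_insert_self _ _)
              (not_le.1 hlt').le
            rcases Finset.mem_insert.1 h3 with h4 | h4
            · exact hlt' h4.ge
            · exact (hb.resolve_left (by rw [hb2]; exact lt_irrefl _)) h4
          rw [mul_comm, add_comm b a] at hne
          rw [add_comm b a] at hab
          have h5 := lt_of_mul_div_eq ha2 hb2 hcre hab hne hbm
          rw [him] at h5
          have h6 : ∀ j, m < j → j ∉ insert m s := by
            intro j hj hmem
            rcases Finset.mem_insert.1 hmem with rfl | h
            · exact lt_irrefl _ hj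
            · exact lt_asymm hj (hs j h)
          exact Y.lie_mem (hY b (Or.inr (h6 _ h5.2)) v hv hvb) (hY a (Or.inr (h6 _ h5.1)) u hu hua)
        · rw [hπ0 _ hne _ hmem]
          exact Y.zero_mem
      intro u hu
      have := h u hu
      change π ⁅v, u⁆ ∈ Y at this
      rw [← lie_skew, map_neg]
      exact Y.neg_mem this
    rw [← hπ1 x hxc]
    rw [← hperf] at hx
    exact derived_induction (S := Y.toSubmodule.comap π)
      (fun u hu v hv => (hW hv).2 u hu) hx

lemma IsRotaBaxter.le_strictLower {f : End ℂ g} (hf : IsRotaBaxter f) {A : LieSubalgebra ℂ g}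
    (hA : ∀ x ∈ A, f x ∈ A) (hp : A ≤ hf.lower) (hperf : A.derived = A) :
    A ≤ hf.strictLower := by
  obtain ⟨M, hM⟩ := exists_finset_im_mem f
  refine hf.le_of_forall_mem hA hp hperf hM M (fun j hj _ _ _ => hj) _ fun c hc x _ hxc => ?_
  rcases hc with hc | hc
  · exact maxGenEigenspace_le_spectralSubspace f hc hxc
  · by_cases hx0 : x = 0
    · rw [hx0]; exact LieSubalgebra.zero_mem _
    · exact absurd (hM c x hxc hx0) hc

lemma IsRotaBaxter.apply_mem_derived {f : End ℂ g} (hf : IsRotaBaxter f) {A : LieSubalgebra ℂ g}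
    (hA : ∀ x ∈ A, f x ∈ A) (hp : A ≤ hf.lower) : ∀ x ∈ A.derived, f x ∈ A.derived := by
  have hsub : ∀ x ∈ A, f x - x ∈ A := fun x hx => A.sub_mem (hA x hx) hx
  have hsurj : ∀ a ∈ A, ∃ x ∈ A, f x - x = a := by
    let F : End ℂ A.toSubmodule := (f - 1).restrict (p := A.toSubmodule) (q := A.toSubmodule) hsub
    have hinj : Function.Injective F := by
      rw [← LinearMap.ker_eq_bot, LinearMap.ker_eq_bot']
      rintro ⟨x, hx⟩ hFx
      have h1 : f x - x = 0 := congrArg Subtype.val hFx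
      have h2 : x ∈ f.maxGenEigenspace 1 := mem_maxGenEigenspace_of_sub_mem (by
        rw [one_smul, h1]; exact Submodule.zero_mem _)
      have := eq_zero_of_mem_spectralSubspace (s := {c | c.re ≤ 1 / 2})
        (by norm_num) (hp hx) h2
      exact Subtype.ext this
    intro a ha
    obtain ⟨⟨x, hx⟩, e⟩ := (LinearMap.injective_iff_surjective.1 hinj) ⟨a, ha⟩
    exact ⟨x, hx, congrArg Subtype.val e⟩
  have hle : A.derived.toSubmodule ≤ A.derived.toSubmodule.map (f - 1) := by
    intro z hz
    refine derived_induction (S := A.derived.toSubmodule.map (f - 1)) ?_ hz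
    intro a ha b hb
    obtain ⟨x, hx, rfl⟩ := hsurj a ha
    obtain ⟨y, hy, rfl⟩ := hsurj b hb
    refine ⟨⁅f x, y⁆ + ⁅x, f y⁆ - ⁅x, y⁆, ?_, ?_⟩
    · exact A.derived.sub_mem (A.derived.add_mem (lie_mem_derived (hA x hx) hy)
        (lie_mem_derived hx (hA y hy))) (lie_mem_derived hx hy)
    · rw [LinearMap.sub_apply, End.one_apply, ← hf x y]
      simp only [sub_lie, lie_sub]
      abel
  have heq := Submodule.eq_of_le_of_finrank_le hle (Submodule.finrank_map_le _ _)
  intro x hx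
  have h1 : (f - 1) x ∈ A.derived.toSubmodule := by
    rw [heq]; exact Submodule.mem_map_of_mem hx
  have h2 := A.derived.add_mem h1 hx
  simpa using h2

lemma IsRotaBaxter.isSolvable_of_le_lower [IsKilling ℂ g] {f : End ℂ g} (hf : IsRotaBaxter f)
    (hK : ∀ x y, killingForm ℂ g (f x) y + killingForm ℂ g x (f y) = killingForm ℂ g x y)
    (n : ℕ) : ∀ A : LieSubalgebra ℂ g, finrank ℂ A = n → (∀ x ∈ A, f x ∈ A) → A ≤ hf.lower →
      IsSolvable A := by
  induction n using Nat.strong_induction_on with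
  | _ n ih =>
    intro A hn hA hp
    by_cases hperf : A.derived = A
    · have hle := hf.le_strictLower hA hp hperf
      refine LieSubalgebra.isSolvable_of_killingForm_eq_zero A fun x hx y hy => ?_
      refine killingForm_eq_zero_of_spectralSubspace hK ?_ (hle hx) (hle hy)
      intro a ha b hb hab
      have := congrArg Complex.re hab
      simp only [Complex.add_re, Complex.one_re, Set.mem_ofPred_eq] at this ha hb
      linarith
    · have hlt : A.derived < A := lt_of_le_of_ne (derived_le A) hperf
      refine isSolvable_of_derived (ih _ ?_ A.derived rfl (hf.apply_mem_derived hA hp)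
        (hlt.le.trans hp))
      rw [← hn]
      exact Submodule.finrank_lt_finrank_of_lt (show A.derived.toSubmodule < A.toSubmodule from hlt)

lemma IsRotaBaxter.isSolvable_lower [IsKilling ℂ g] {f : End ℂ g} (hf : IsRotaBaxter f)
    (hK : ∀ x y, killingForm ℂ g (f x) y + killingForm ℂ g x (f y) = killingForm ℂ g x y) :
    IsSolvable hf.lower :=
  hf.isSolvable_of_le_lower hK _ _ rfl (fun _ hx => apply_mem_spectralSubspace f hx) le_rfl

end SpectralSolvable

section SpectralTrace

open LieAlgebra LieSubalgebra Module

variable {g : Type*} [LieRing g] [LieAlgebra ℂ g] [FiniteDimensional ℂ g]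

lemma IsRotaBaxter.trace_proj_mul_ad_mul_eq_zero {f : End ℂ g} (hf : IsRotaBaxter f) {π : End ℂ g}
    (h1 : π * π = π) (h2 : π * f = f * π) (h3 : ∀ x, π x = x → f x = x → x = 0) (x : g) :
    LinearMap.trace ℂ g (π * (ad ℂ g x * f)) = 0 := by
  let T : End ℂ g := (1 - f) * π + (1 - π)
  have hπT : π * T = (1 - f) * π := by
    calc π * T = (π - π * f) * π + (π - π * π) := by simp only [T]; noncomm_ring
      _ = π * π - f * (π * π) + (π - π * π) := by rw [h2]; noncomm_ring
      _ = (1 - f) * π := by rw [h1]; noncomm_ring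
  have hTπ : T * π = (1 - f) * π := by
    calc T * π = (1 - f) * (π * π) + (π - π * π) := by simp only [T]; noncomm_ring
      _ = (1 - f) * π := by rw [h1]; noncomm_ring
  have hTf : T * f = f * T := by
    calc T * f = (1 - f) * (π * f) + (f - π * f) := by simp only [T]; noncomm_ring
      _ = f * T := by rw [h2]; simp only [T]; noncomm_ring
  have hinj : LinearMap.ker T = ⊥ := by
    refine LinearMap.ker_eq_bot'.2 fun v hv => ?_
    have e1 : (1 - f) (π v) = 0 := by
      have := congrArg (fun φ : End ℂ g => φ v) hπT
      simp only [End.mul_apply, hv, map_zero] at this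
      exact this.symm
    have e2 : π v = 0 := by
      refine h3 _ ?_ ?_
      · rw [← End.mul_apply, h1]
      · rw [LinearMap.sub_apply, End.one_apply, sub_eq_zero] at e1
        exact e1.symm
    have e3 : T v = v := by
      simp only [T, LinearMap.add_apply, End.mul_apply, LinearMap.sub_apply, End.one_apply, e2,
        map_zero, sub_zero, zero_add]
    rw [← e3, hv]
  obtain ⟨U, hU⟩ := (LinearMap.isUnit_iff_ker_eq_bot T).2 hinj
  let R : End ℂ g := ↑U⁻¹ * π
  have hUf : ↑U⁻¹ * f = f * ↑U⁻¹ := by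
    have : Commute (U : End ℂ g) f := by rw [hU]; exact hTf
    exact this.units_inv_left
  have hRf : R * f = f * R := by
    simp only [R, mul_assoc, h2]
    rw [← mul_assoc, hUf, mul_assoc]
  have hR : R * (1 - f) = π := by
    have : π * (1 - f) = T * π := by rw [hTπ, mul_sub, sub_mul, h2, mul_one, one_mul]
    rw [show R * (1 - f) = ↑U⁻¹ * (π * (1 - f)) from mul_assoc _ _ _, this, ← hU, ← mul_assoc,
      Units.inv_mul, one_mul]
  have key : (1 - f) * (ad ℂ g x * f) = f * ad ℂ g (f x - x) - ad ℂ g (f x - x) * f := by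
    ext y
    have := hf x y
    simp only [map_add, map_sub] at this
    simp only [End.mul_apply, LinearMap.sub_apply, End.one_apply, ad_apply, map_sub, this]
    abel
  rw [← hR, mul_assoc, key, mul_sub, map_sub, ← mul_assoc, hRf, mul_assoc, ← mul_assoc R,
    LinearMap.trace_mul_comm ℂ (R * ad ℂ g (f x - x)) f, sub_self]

lemma exists_add_spectralSubspace (f : End ℂ g) (s : Set ℂ) (v : g) :
    ∃ y ∈ spectralSubspace f s, ∃ z ∈ spectralSubspace f sᶜ, y + z = v := by
  refine Submodule.mem_sup.1 ?_
  rw [(isCompl_spectralSubspace f s).sup_eq_top]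
  exact Submodule.mem_top

variable [IsKilling ℂ g]

lemma trace_ad_eq_zero (x : g) : LinearMap.trace ℂ g (ad ℂ g x) = 0 := by
  let φ : Dual ℂ g := LinearMap.trace ℂ g ∘ₗ (ad ℂ g : g →ₗ[ℂ] End ℂ g)
  obtain ⟨h, hh⟩ := (LinearMap.BilinForm.toDual (killingForm ℂ g)
    (IsKilling.killingForm_nondegenerate ℂ g)).surjective φ
  have hφ : ∀ y, killingForm ℂ g h y = LinearMap.trace ℂ g (ad ℂ g y) := fun y => by
    rw [← LinearMap.BilinForm.toDual_def (IsKilling.killingForm_nondegenerate ℂ g), hh]; rfl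
  have hz : ∀ y : g, ⁅h, y⁆ = 0 := fun y => by
    refine eq_zero_of_killingForm fun z => ?_
    rw [killingForm_lie_left, hφ]
    have : ad ℂ g ⁅y, z⁆ = ad ℂ g y * ad ℂ g z - ad ℂ g z * ad ℂ g y := by
      ext w; exact lie_lie y z w
    rw [this, map_sub, LinearMap.trace_mul_comm, sub_self]
  rw [← hφ]
  have : ad ℂ g h = 0 := by ext y; exact hz y
  rw [killingForm_apply_apply, this]
  simp

lemma IsRotaBaxter.killingPerp_lower_le {f : End ℂ g} (hf : IsRotaBaxter f)
    (hK : ∀ x y, killingForm ℂ g (f x) y + killingForm ℂ g x (f y) = killingForm ℂ g x y) :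
    killingPerp hf.lower.toSubmodule ≤ hf.lower.toSubmodule := by
  intro x hx
  have hx' := mem_killingPerp.1 hx
  have hre : ∀ a b : ℂ, a + b = 1 → a.re + b.re = 1 := fun a b h => by
    simpa using congrArg Complex.re h
  obtain ⟨y, hy, z, hz, rfl⟩ := exists_add_spectralSubspace f {c | c.re < 1 / 2} x
  have hz0 : z = 0 := by
    refine eq_zero_of_killingForm fun w => ?_
    obtain ⟨w₁, hw₁, w₂, hw₂, rfl⟩ := exists_add_spectralSubspace f {c | c.re ≤ 1 / 2} w
    have e1 : killingForm ℂ g z w₂ = 0 := by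
      refine killingForm_eq_zero_of_spectralSubspace hK (fun a ha b hb hab => ?_) hz hw₂
      have := hre a b hab
      simp only [Set.mem_compl_iff, Set.mem_ofPred_eq, not_lt, not_le] at ha hb
      linarith
    have e2 : killingForm ℂ g y w₁ = 0 := by
      refine killingForm_eq_zero_of_spectralSubspace hK (fun a ha b hb hab => ?_) hy hw₁
      have := hre a b hab
      simp only [Set.mem_ofPred_eq] at ha hb
      linarith
    have e3 := hx' w₁ hw₁
    rw [map_add, LinearMap.add_apply, e2, zero_add] at e3
    rw [map_add, e1, e3, add_zero]
  rw [hz0, add_zero]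
  have hsub : {c : ℂ | c.re < 1 / 2} ⊆ {c : ℂ | c.re ≤ 1 / 2} := fun c hc => by
    simp only [Set.mem_ofPred_eq] at hc ⊢
    exact hc.le
  exact spectralSubspace_mono f hsub hy

lemma IsRotaBaxter.exists_maximal_isSolvable {f : End ℂ g} (hf : IsRotaBaxter f)
    (hK : ∀ x y, killingForm ℂ g (f x) y + killingForm ℂ g x (f y) = killingForm ℂ g x y) :
    ∃ b : LieSubalgebra ℂ g, Maximal (fun B : LieSubalgebra ℂ g => IsSolvable B) b ∧
      ∀ E : End ℂ g, (∀ v, E v ∈ killingPerp b.toSubmodule) →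
        (∀ v ∈ killingPerp b.toSubmodule, E v = v) → ∀ x ∈ b,
        LinearMap.trace ℂ g (ad ℂ g x * f) = - LinearMap.trace ℂ g (E * ad ℂ g x) := by
  obtain ⟨b, hle, hb⟩ := exists_le_maximal_isSolvable hf.lower (hf.isSolvable_lower hK)
  refine ⟨b, hb, fun E hE1 hE2 x hx => ?_⟩
  obtain ⟨P, hP1, hP0, hPm, hPf⟩ := exists_spectralProjection f {c | c.re ≤ 1 / 2}
  have hPP : P * P = P := by ext v; exact hP1 _ (hPm v)
  have hPf' : P * f = f * P := by ext v; exact hPf v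
  have hc : killingPerp b.toSubmodule ≤ hf.lower.toSubmodule := by
    refine le_trans (fun v hv => mem_killingPerp.2 fun w hw => ?_) (hf.killingPerp_lower_le hK)
    exact mem_killingPerp.1 hv w (hle hw)
  have t1 : LinearMap.trace ℂ g (P * (ad ℂ g x * f)) = 0 := by
    refine hf.trace_proj_mul_ad_mul_eq_zero hPP hPf' (fun v hv hfv => ?_) x
    refine eq_zero_of_mem_spectralSubspace (f := f) (s := {c | c.re ≤ 1 / 2}) (c := 1)
      (by norm_num) (hv ▸ hPm v) (mem_maxGenEigenspace_of_sub_mem ?_)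
    rw [hfv, one_smul, sub_self]
    exact Submodule.zero_mem _
  have t2 : LinearMap.trace ℂ g ((1 - P) * (ad ℂ g x * (1 - f))) = 0 := by
    refine hf.one_sub.trace_proj_mul_ad_mul_eq_zero ?_ ?_ (fun v hv hfv => ?_) x
    · calc (1 - P) * (1 - P) = 1 - P - P + P * P := by noncomm_ring
        _ = 1 - P := by rw [hPP]; abel
    · calc (1 - P) * (1 - f) = 1 - P - f + P * f := by noncomm_ring
        _ = (1 - f) * (1 - P) := by rw [hPf']; noncomm_ring
    · have hPv : P v = 0 := by simpa using hv
      have hfv' : f v = 0 := by simpa using hfv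
      rw [← hPv, hP1 v (maxGenEigenspace_le_spectralSubspace f (c := 0) (by norm_num)
        (mem_maxGenEigenspace_of_sub_mem ?_))]
      rw [hfv', zero_smul, sub_self]
      exact Submodule.zero_mem _
  have t3 : LinearMap.trace ℂ g (P * ad ℂ g x) = LinearMap.trace ℂ g (E * ad ℂ g x) := by
    have e1 : ad ℂ g x * P = E * (ad ℂ g x * P) := by
      ext v
      exact (hE2 _ (lie_mem_killingPerp_of_isSolvable hb.prop hx (hle (hPm v)))).symm
    have e2 : P * E = E := by ext v; exact hP1 _ (hc (hE1 v))
    rw [LinearMap.trace_mul_comm, e1, ← mul_assoc, LinearMap.trace_mul_comm, ← mul_assoc, e2]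
  have e : ad ℂ g x * f = P * (ad ℂ g x * f) - (1 - P) * (ad ℂ g x * (1 - f)) + ad ℂ g x
      - P * ad ℂ g x := by noncomm_ring
  rw [e, map_sub, map_add, map_sub, t1, t2, t3, trace_ad_eq_zero]
  ring

end SpectralTrace

section Sl2

open LieModule Module Finset

variable {L M : Type*} [LieRing L] [LieAlgebra ℂ L] [AddCommGroup M] [Module ℂ M]
  [LieRingModule L M] [LieModule ℂ L M] {h e f : L}

lemma IsSl2Triple.HasPrimitiveVectorWith.pow_toEnd_e_pow_toEnd_f {t : IsSl2Triple h e f} {u : M}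
    {μ : ℂ} (P : t.HasPrimitiveVectorWith u μ) (n : ℕ) :
    (toEnd ℂ L M e ^ n) ((toEnd ℂ L M f ^ n) u) = (∏ l ∈ range n, ((l + 1) * (μ - l))) • u := by
  induction n with
  | zero => simp
  | succ n ih =>
    have := P.lie_e_pow_succ_toEnd_f n
    rw [pow_succ, End.mul_apply, toEnd_apply_apply, this, map_smul, ih, smul_smul,
      prod_range_succ, mul_comm]

lemma prod_add_one_mul_sub_ne_zero {n N : ℕ} (h : n ≤ N) :
    ∏ l ∈ range n, (((l : ℂ) + 1) * (N - l)) ≠ 0 := by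
  refine prod_ne_zero_iff.2 fun l hl => mul_ne_zero (Nat.cast_add_one_ne_zero l) ?_
  rw [sub_ne_zero]
  have := mem_range.1 hl
  exact_mod_cast (by omega : N ≠ l)

lemma IsSl2Triple.exists_pow_toEnd_e_pow_toEnd_f (t : IsSl2Triple h e f) (k i : ℕ) (v : M)
    (hv : ⁅h, v⁆ = (k : ℂ) • v) (hi : (toEnd ℂ L M e ^ (i + 1)) v = 0) :
    ∃ d : ℂ, d ≠ 0 ∧ (toEnd ℂ L M e ^ (k + i)) ((toEnd ℂ L M f ^ k) v) =
      d • (toEnd ℂ L M e ^ i) v := by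
  induction i generalizing v with
  | zero =>
    by_cases h0 : v = 0
    · exact ⟨1, one_ne_zero, by simp [h0]⟩
    have P : t.HasPrimitiveVectorWith v (k : ℂ) := ⟨h0, hv, by simpa using hi⟩
    exact ⟨_, prod_add_one_mul_sub_ne_zero le_rfl, by simpa using P.pow_toEnd_e_pow_toEnd_f k⟩
  | succ i ih =>
    by_cases h0 : (toEnd ℂ L M e ^ (i + 1)) v = 0
    · obtain ⟨d, hd, hd'⟩ := ih v hv h0
      refine ⟨d, hd, ?_⟩
      rw [← add_assoc, pow_succ', End.mul_apply, hd', map_smul, ← End.mul_apply, ← pow_succ']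
    have P : t.HasPrimitiveVectorWith ((toEnd ℂ L M e ^ (i + 1)) v)
        ((k + 2 * (i + 1) : ℕ) : ℂ) := by
      refine ⟨h0, ?_, ?_⟩
      · rw [t.lie_h_pow_toEnd_e hv]
        push_cast
        rfl
      · rw [← toEnd_apply_apply ℂ, ← End.mul_apply, ← pow_succ', hi]
    set u := (toEnd ℂ L M e ^ (i + 1)) v with hu
    have hC := prod_add_one_mul_sub_ne_zero (show i + 1 ≤ k + 2 * (i + 1) by omega)
    have hC' := prod_add_one_mul_sub_ne_zero (show k + (i + 1) ≤ k + 2 * (i + 1) by omega)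
    have e1 := P.pow_toEnd_e_pow_toEnd_f (i + 1)
    have e2 := P.pow_toEnd_e_pow_toEnd_f (k + (i + 1))
    have e3 := P.lie_h_pow_toEnd_f (i + 1)
    set C := ∏ l ∈ range (i + 1), (((l : ℂ) + 1) * (((k + 2 * (i + 1) : ℕ) : ℂ) - l))
    set C' := ∏ l ∈ range (k + (i + 1)), (((l : ℂ) + 1) * (((k + 2 * (i + 1) : ℕ) : ℂ) - l))
    have hw : (((k + 2 * (i + 1) : ℕ) : ℂ) - 2 * (i + 1 : ℕ)) = k := by push_cast; ring
    rw [hw] at e3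
    have hv0 : (toEnd ℂ L M e ^ (i + 1)) (v - C⁻¹ • (toEnd ℂ L M f ^ (i + 1)) u) = 0 := by
      rw [map_sub, map_smul, e1, smul_smul, inv_mul_cancel₀ hC, one_smul, sub_self]
    obtain ⟨d, -, hd⟩ := ih (v - C⁻¹ • (toEnd ℂ L M f ^ (i + 1)) u)
      (by rw [lie_sub, lie_smul, e3, hv, smul_sub, smul_comm]) hv0
    have e4 : (toEnd ℂ L M e ^ (k + (i + 1))) ((toEnd ℂ L M f ^ k)
        (v - C⁻¹ • (toEnd ℂ L M f ^ (i + 1)) u)) = 0 := by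
      rw [← add_assoc, pow_succ', End.mul_apply, hd, map_smul, ← End.mul_apply, ← pow_succ', hv0,
        smul_zero]
    rw [map_sub, map_smul, map_sub, map_smul, ← End.mul_apply (toEnd ℂ L M f ^ k), ← pow_add, e2,
      sub_eq_zero, smul_smul] at e4
    exact ⟨C⁻¹ * C', mul_ne_zero (inv_ne_zero hC) hC', e4⟩

lemma IsSl2Triple.eq_zero_of_pow_toEnd_f (t : IsSl2Triple h e f) {k i : ℕ} {v : M}
    (hv : ⁅h, v⁆ = (k : ℂ) • v) (hf : (toEnd ℂ L M f ^ k) v = 0)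
    (he : (toEnd ℂ L M e ^ i) v = 0) : v = 0 := by
  induction i with
  | zero => simpa using he
  | succ i ih =>
    obtain ⟨d, hd, hd'⟩ := t.exists_pow_toEnd_e_pow_toEnd_f k i v hv he
    rw [hf, map_zero, eq_comm, smul_eq_zero_iff_right hd] at hd'
    exact ih hd'

lemma IsSl2Triple.eq_zero_of_pow_toEnd_e (t : IsSl2Triple h e f) {k i : ℕ} {v : M}
    (hv : ⁅h, v⁆ = -(k : ℂ) • v) (he : (toEnd ℂ L M e ^ k) v = 0)
    (hf : (toEnd ℂ L M f ^ i) v = 0) : v = 0 :=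
  t.symm.eq_zero_of_pow_toEnd_f (by rw [neg_lie, hv, neg_smul, neg_neg]) he hf

end Sl2

section TracePositivity

open LieAlgebra LieModule Module Finset

lemma Module.End.trace_eq_sum_finrank_maxGenEigenspace {V : Type*} [AddCommGroup V] [Module ℂ V]
    [FiniteDimensional ℂ V] (φ : End ℂ V) {S : Finset ℂ}
    (hS : φ.charpoly.roots.toFinset ⊆ S) :
    LinearMap.trace ℂ V φ = ∑ μ ∈ S, (finrank ℂ (φ.maxGenEigenspace μ) : ℂ) * μ := by
  rw [Module.End.trace_eq_sum_roots_charpoly_of_splits (IsAlgClosed.splits _),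
    sum_multiset_count_of_subset _ S hS]
  simp [LinearMap.finrank_maxGenEigenspace_eq, Polynomial.count_roots]

lemma Module.End.trace_ne_zero_of_finrank_neg_le {V : Type*} [AddCommGroup V] [Module ℂ V]
    [FiniteDimensional ℂ V] (φ : End ℂ V)
    (h : ∀ μ : ℂ, 0 < μ.re →
      finrank ℂ (φ.maxGenEigenspace (-μ)) ≤ finrank ℂ (φ.maxGenEigenspace μ))
    (h' : ∃ μ : ℂ, 0 < μ.re ∧
      finrank ℂ (φ.maxGenEigenspace (-μ)) < finrank ℂ (φ.maxGenEigenspace μ)) :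
    LinearMap.trace ℂ V φ ≠ 0 := by
  obtain ⟨ν, hν, hν'⟩ := h'
  let R : Finset ℂ := insert ν φ.charpoly.roots.toFinset
  let S : Finset ℂ := R ∪ R.image Neg.neg
  let m : ℂ → ℝ := fun μ => finrank ℂ (φ.maxGenEigenspace μ)
  have hS : ∀ μ ∈ S, -μ ∈ S := by
    intro μ hμ
    simp only [S, mem_union, mem_image] at hμ ⊢
    rcases hμ with hμ | ⟨a, ha, rfl⟩
    · exact Or.inr ⟨μ, hμ, rfl⟩
    · exact Or.inl (by rwa [neg_neg])
  have htr : (LinearMap.trace ℂ V φ).re = ∑ μ ∈ S, m μ * μ.re := by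
    rw [φ.trace_eq_sum_finrank_maxGenEigenspace (S := S)
      ((subset_insert _ _).trans subset_union_left), Complex.re_sum]
    refine sum_congr rfl fun μ _ => ?_
    simp [m]
  have hneg : ∑ μ ∈ S, m (-μ) * μ.re = - ∑ μ ∈ S, m μ * μ.re := by
    rw [← sum_neg_distrib]
    exact sum_nbij' (fun μ => -μ) (fun μ => -μ) hS hS (by simp) (by simp) (by simp)
  have hpos : 0 < ∑ μ ∈ S, (m μ - m (-μ)) * μ.re := by
    refine sum_pos' (fun μ _ => ?_) ⟨ν, by simp [S, R], ?_⟩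
    · rcases lt_trichotomy μ.re 0 with h1 | h1 | h1
      · have : m (- -μ) ≤ m (-μ) := Nat.cast_le.2 (h (-μ) (by simpa using h1))
        rw [neg_neg] at this
        nlinarith
      · simp [h1]
      · have : m (-μ) ≤ m μ := Nat.cast_le.2 (h μ h1)
        nlinarith
    · have : m (-ν) < m ν := Nat.cast_lt.2 hν'
      nlinarith
  intro h0
  rw [h0, Complex.zero_re] at htr
  simp only [sub_mul, sum_sub_distrib, hneg, ← htr] at hpos
  simp at hpos

variable {g : Type*} [LieRing g] [LieAlgebra ℂ g] [FiniteDimensional ℂ g] {h e f : g}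

lemma IsSl2Triple.exists_nat_of_lie_eq_neg_smul (t : IsSl2Triple h e f)
    (he : IsNilpotent (ad ℂ g e)) {v : g} (hv0 : v ≠ 0) {μ : ℂ} (hμ : 0 < μ.re)
    (hv : ⁅h, v⁆ = -μ • v) : ∃ k : ℕ, μ = k := by
  obtain ⟨n, hn⟩ := he
  have hex : ∃ n, (toEnd ℂ g g e ^ n) v = 0 := ⟨n, by
    change (ad ℂ g e ^ n) v = 0
    rw [hn, LinearMap.zero_apply]⟩
  obtain ⟨j, hj, hj'⟩ := Nat.exists_not_and_succ_of_not_zero_of_exists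
    (p := fun n => (toEnd ℂ g g e ^ n) v = 0) (by simpa using hv0) hex
  have P : t.HasPrimitiveVectorWith ((toEnd ℂ g g e ^ j) v) (-μ + 2 * j) :=
    ⟨hj, t.lie_h_pow_toEnd_e hv j, by
      rw [← toEnd_apply_apply ℂ, ← End.mul_apply, ← pow_succ', hj']⟩
  obtain ⟨N, hN⟩ := P.exists_nat
  have e1 : μ = ((2 * j - N : ℤ) : ℂ) := by
    push_cast
    linear_combination -hN
  have e2 : (0 : ℤ) < 2 * j - N := by
    rw [e1, Complex.intCast_re] at hμ
    exact_mod_cast hμ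
  refine ⟨(2 * j - N : ℤ).toNat, ?_⟩
  rw [e1]
  exact_mod_cast (Int.toNat_of_nonneg e2.le).symm

lemma IsSl2Triple.trace_restrict_ne_zero (t : IsSl2Triple h e f)
    (hs : (ad ℂ g h).IsSemisimple) (he : IsNilpotent (ad ℂ g e)) (hf : IsNilpotent (ad ℂ g f))
    {c : Submodule ℂ g} (hce : ∀ x ∈ c, ad ℂ g e x ∈ c) (hch : ∀ x ∈ c, ad ℂ g h x ∈ c)
    (hec : e ∈ c) (hcK : ∀ x ∈ c, killingForm ℂ g x e = 0) (hef : killingForm ℂ g e f ≠ 0) :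
    LinearMap.trace ℂ c ((ad ℂ g h).restrict hch) ≠ 0 := by
  set φ : End ℂ c := (ad ℂ g h).restrict hch with hφ
  set ε : End ℂ c := (ad ℂ g e).restrict hce with hε
  have hφs : φ.IsSemisimple := Module.End.IsSemisimple.restrict hch hs
  have hmax : ∀ μ, φ.maxGenEigenspace μ = φ.eigenspace μ :=
    hφs.isFinitelySemisimple.maxGenEigenspace_eq_eigenspace
  have hmem : ∀ (μ : ℂ) (x : c), x ∈ φ.eigenspace μ ↔ ⁅h, (x : g)⁆ = μ • (x : g) := by
    intro μ x
    rw [End.mem_eigenspace_iff, Subtype.ext_iff]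
    rfl
  have hpow : ∀ (n : ℕ) (x : c), ((ε ^ n) x : g) = (toEnd ℂ g g e ^ n) x := by
    intro n x
    rw [hε, Module.End.pow_restrict]
    rfl
  have hmaps : ∀ k : ℕ, ∀ x ∈ φ.eigenspace (-(k : ℂ)), (ε ^ k) x ∈ φ.eigenspace (k : ℂ) := by
    intro k x hx
    rw [hmem] at hx ⊢
    rw [hpow, t.lie_h_pow_toEnd_e hx]
    congr 1
    ring
  have hinj : ∀ k : ℕ, Function.Injective ((ε ^ k).restrict (hmaps k)) := by
    intro k
    rw [← LinearMap.ker_eq_bot, LinearMap.ker_eq_bot']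
    intro x hx
    obtain ⟨i, hi⟩ := hf
    have e1 : (x : c) ∈ φ.eigenspace (-(k : ℂ)) := x.2
    rw [hmem] at e1
    have e2 : (ε ^ k) (x : c) = 0 := congrArg Subtype.val hx
    have e3 : (toEnd ℂ g g e ^ k) ((x : c) : g) = 0 := by rw [← hpow, e2]; rfl
    have e4 : (toEnd ℂ g g f ^ i) ((x : c) : g) = 0 := by
      change (ad ℂ g f ^ i) _ = 0
      rw [hi, LinearMap.zero_apply]
    exact Subtype.ext (Subtype.ext (t.eq_zero_of_pow_toEnd_e e1 e3 e4))
  refine φ.trace_ne_zero_of_finrank_neg_le (fun μ hμ => ?_) ⟨(2 : ℕ), by norm_num, ?_⟩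
  · rw [hmax, hmax]
    by_cases h0 : φ.eigenspace (-μ) = ⊥
    · rw [h0, finrank_bot]
      exact Nat.zero_le _
    obtain ⟨v, hv, hv0⟩ := Submodule.exists_mem_ne_zero_of_ne_bot h0
    obtain ⟨k, rfl⟩ := t.exists_nat_of_lie_eq_neg_smul he (v := v) (by simpa using hv0) hμ
      ((hmem _ _).1 hv)
    exact LinearMap.finrank_le_finrank_of_injective (hinj k)
  · rw [hmax, hmax]
    refine lt_of_le_of_ne (LinearMap.finrank_le_finrank_of_injective (hinj 2)) fun heq => hef ?_
    have hsurj := (LinearMap.injective_iff_surjective_of_finrank_eq_finrank heq).1 (hinj 2)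
    have hE : (⟨e, hec⟩ : c) ∈ φ.eigenspace ((2 : ℕ) : ℂ) := by
      rw [hmem]
      simpa using t.lie_h_e_smul ℂ
    obtain ⟨v, hv⟩ := hsurj ⟨⟨e, hec⟩, hE⟩
    have e1 : (ε ^ 2) (v : c) = ⟨e, hec⟩ := congrArg Subtype.val hv
    have e2 : ⁅e, ⁅e, ((v : c) : g)⁆⁆ = e := by
      have := congrArg Subtype.val e1
      rw [hpow] at this
      simpa [pow_two] using this
    have e3 : ⁅⁅f, e⁆, e⁆ = -(2 : ℂ) • e := by
      rw [← lie_skew f e, t.lie_e_f, neg_lie, t.lie_h_e_smul ℂ, neg_smul]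
    calc killingForm ℂ g e f = killingForm ℂ g f ⁅e, ⁅e, ((v : c) : g)⁆⁆ := by
          rw [e2, killingForm_comm]
      _ = killingForm ℂ g ⁅⁅f, e⁆, e⁆ ((v : c) : g) := by
          rw [killingForm_lie_left, killingForm_lie_left]
      _ = 0 := by rw [e3, map_smul, LinearMap.smul_apply, killingForm_comm, hcK _ (v : c).2,
                    smul_zero]

end TracePositivity

section BorelTrace

open LieAlgebra LieModule Module LieSubalgebra

variable {g : Type*} [LieRing g] [LieAlgebra ℂ g] [FiniteDimensional ℂ g] [IsKilling ℂ g]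

lemma engel_le_of_forall_weight_ne_zero {t : LieSubalgebra ℂ g} [t.IsCartanSubalgebra] (S : t)
    (h : ∀ χ : Weight ℂ t g, χ.IsNonZero → χ S ≠ 0) : engel ℂ (S : g) ≤ t := by
  have hx : ∀ x : g, ∃ a ∈ t, ∃ b ∈ spectralSubspace (ad ℂ g (S : g)) {0}ᶜ, x = a + b := by
    intro x
    have hx : x ∈ ⨆ χ : Weight ℂ t g, genWeightSpace g χ := by
      rw [iSup_genWeightSpace_eq_top']
      trivial
    induction hx using LieSubmodule.iSup_induction' with
    | mem χ x hx =>
      by_cases hχ : χ.IsZero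
      · refine ⟨x, ?_, 0, zero_mem _, (add_zero x).symm⟩
        have hχ' : (χ : t → ℂ) = 0 := hχ
        rw [hχ'] at hx
        have := (rootSpace_zero_eq ℂ g t).le hx
        simpa using this
      · refine ⟨0, zero_mem _, x, ?_, (zero_add x).symm⟩
        have hc : χ S ∈ ({0}ᶜ : Set ℂ) := by
          rw [Set.mem_compl_singleton_iff]
          exact h χ hχ
        have hxS : ad ℂ g (S : g) x = χ S • x := IsKilling.lie_eq_smul_of_mem_rootSpace hx S
        refine maxGenEigenspace_le_spectralSubspace _ hc ?_
        rw [End.mem_maxGenEigenspace]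
        exact ⟨1, by simp [hxS]⟩
    | zero => exact ⟨0, zero_mem _, 0, zero_mem _, (add_zero 0).symm⟩
    | add x y _ _ hx hy =>
      obtain ⟨a, ha, b, hb, rfl⟩ := hx
      obtain ⟨a', ha', b', hb', rfl⟩ := hy
      exact ⟨a + a', add_mem ha ha', b + b', add_mem hb hb', add_add_add_comm _ _ _ _⟩
  have hS : ∀ x, x ∈ engel ℂ (S : g) ↔ x ∈ spectralSubspace (ad ℂ g (S : g)) {0} := by
    intro x
    simp only [spectralSubspace, Set.mem_singleton_iff, iSup_iSup_eq_left, mem_engel_iff,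
      End.mem_maxGenEigenspace, zero_smul, sub_zero]
  intro x hxS
  obtain ⟨a, ha, b, hb, rfl⟩ := hx x
  have haS : a ∈ engel ℂ (S : g) := by
    rw [mem_engel_iff]
    refine ⟨1, ?_⟩
    rw [pow_one, ad_apply]
    have : ⁅S, (⟨a, ha⟩ : t)⁆ = 0 := trivial_lie_zero _ _ _ _
    exact congrArg Subtype.val this
  have hbS : b ∈ engel ℂ (S : g) := by simpa using sub_mem hxS haS
  have : b = 0 := (Submodule.disjoint_def.1 (isCompl_spectralSubspace _ _).disjoint) b
    ((hS b).1 hbS) hb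
  rwa [this, add_zero]

variable {b : LieSubalgebra ℂ g} (hb : Maximal (fun B : LieSubalgebra ℂ g => IsSolvable B) b)
include hb

lemma mem_or_mem_killingPerp_of_isSl2Triple {t : LieSubalgebra ℂ g} [t.IsCartanSubalgebra]
    (htb : t ≤ b) {α : Weight ℂ t g} (hα : α.IsNonZero) {h e f : g} (T : IsSl2Triple h e f)
    (he : e ∈ rootSpace t α) (hf : f ∈ rootSpace t (-α)) (hh : h ∈ b) :
    e ∈ killingPerp b.toSubmodule ∨ f ∈ killingPerp b.toSubmodule := by
  by_contra! hcon
  let N : LieSubmodule ℂ t g := { killingPerp b.toSubmodule with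
    lie_mem := fun {x m} hm => lie_mem_killingPerp_of_isSolvable hb.1 (htb x.2)
      (killingPerp_le_of_maximal hb hm) }
  have hN : ∀ x, x ∈ N ↔ x ∈ killingPerp b.toSubmodule := fun x => Iff.rfl
  have hfb : f ∈ b := by
    rw [← mem_toSubmodule, ← killingPerp_killingPerp b.toSubmodule, mem_killingPerp]
    intro z hz
    rw [← hN, eq_iSup_inf_genWeightSpace ℂ t g N] at hz
    induction hz using LieSubmodule.iSup_induction' with
    | mem χ x hx =>
      obtain ⟨hx1, hx2⟩ := (LieSubmodule.mem_inf _ _ _).1 hx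
      by_cases hχ : (χ : t → ℂ) = α
      · rw [hχ] at hx2
        by_cases hx0 : x = 0
        · rw [hx0, map_zero]
        · have hx0' : (⟨x, hx2⟩ : rootSpace t α) ≠ 0 := by simpa using hx0
          obtain ⟨c, hc⟩ := (finrank_eq_one_iff_of_nonzero' _ hx0').1
            (IsKilling.finrank_rootSpace_eq_one α hα) ⟨e, he⟩
          have hc' : c • x = e := congrArg Subtype.val hc
          exact (hcon.1 (hc' ▸ Submodule.smul_mem _ c hx1)).elim
      · refine killingForm_apply_eq_zero_of_mem_rootSpace_of_add_ne_zero ℂ g t hf hx2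
          fun h0 => hχ ?_
        rwa [neg_add_eq_zero, eq_comm] at h0
    | zero => rw [map_zero]
    | add x y _ _ hx hy => rw [map_add, hx, hy, add_zero]
  have := lie_mem_killingPerp_of_isSolvable hb.1 hh hfb
  rw [T.lie_lie_smul_f ℂ, neg_mem_iff, Submodule.smul_mem_iff _ two_ne_zero] at this
  exact hcon.2 this

variable {E : End ℂ g} (hE1 : ∀ v, E v ∈ killingPerp b.toSubmodule)
  (hE2 : ∀ v ∈ killingPerp b.toSubmodule, E v = v)
include hE1 hE2

lemma trace_mul_ad_ne_zero_of_isSl2Triple {h e f : g} (T : IsSl2Triple h e f)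
    (hs : (ad ℂ g h).IsSemisimple) (he : IsNilpotent (ad ℂ g e)) (hf : IsNilpotent (ad ℂ g f))
    (hh : h ∈ b) (hec : e ∈ killingPerp b.toSubmodule) (hef : killingForm ℂ g e f ≠ 0) :
    LinearMap.trace ℂ g (E * ad ℂ g h) ≠ 0 := by
  have hcb := killingPerp_le_of_maximal hb
  have hc : ∀ y ∈ b, ∀ x ∈ killingPerp b.toSubmodule, ad ℂ g y x ∈ killingPerp b.toSubmodule :=
    fun y hy x hx => lie_mem_killingPerp_of_isSolvable hb.1 hy (hcb hx)
  have := T.trace_restrict_ne_zero hs he hf (hc e (hcb hec)) (hc h hh) hec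
    (fun x hx => mem_killingPerp.1 hx e (hcb hec)) hef
  rw [← LinearMap.trace_restrict_eq_of_forall_mem (killingPerp b.toSubmodule) _
    (fun x => hE1 (ad ℂ g h x))]
  convert this using 2
  ext x
  exact hE2 _ (hc h hh x x.2)

lemma trace_mul_ad_eq_zero_of_mem_killingPerp {x : g} (hx : x ∈ killingPerp b.toSubmodule) :
    LinearMap.trace ℂ g (E * ad ℂ g x) = 0 := by
  have hcb := killingPerp_le_of_maximal hb
  have hEE : E * E = E := LinearMap.ext fun v => hE2 _ (hE1 v)
  have h1 : E * (ad ℂ g x * E) = ad ℂ g x * E := LinearMap.ext fun v =>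
    hE2 _ (lie_mem_killingPerp_of_isSolvable hb.1 (hcb hx) (hcb (hE1 v)))
  have h2 : ∀ n : ℕ, (ad ℂ g x * E) ^ (n + 1) = ad ℂ g x ^ (n + 1) * E := by
    intro n
    induction n with
    | zero => simp
    | succ n ih => rw [pow_succ, ih, pow_succ _ (n + 1), mul_assoc, h1, mul_assoc]
  obtain ⟨n, hn⟩ := isNilpotent_ad_of_mem_killingPerp hb hx
  have h3 : IsNilpotent (ad ℂ g x * E) := ⟨n + 1, by rw [h2, pow_succ, hn, zero_mul, zero_mul]⟩
  calc LinearMap.trace ℂ g (E * ad ℂ g x) = LinearMap.trace ℂ g (ad ℂ g x * E) :=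
        LinearMap.trace_mul_comm ℂ _ _
    _ = 0 := (LinearMap.isNilpotent_trace_of_isNilpotent h3).eq_zero

lemma isRegular_of_killingForm_eq_neg_trace {H : g}
    (hH : ∀ x ∈ b, killingForm ℂ g H x = - LinearMap.trace ℂ g (E * ad ℂ g x)) :
    IsRegular ℂ H := by
  have hcb := killingPerp_le_of_maximal hb
  have hHb : H ∈ b.toSubmodule := by
    rw [← killingPerp_killingPerp b.toSubmodule, mem_killingPerp]
    intro x hx
    rw [hH x (hcb hx), trace_mul_ad_eq_zero_of_mem_killingPerp hb hE1 hE2 hx, neg_zero]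
  obtain ⟨y, hyb, hy⟩ := exists_isRegular_mem_of_maximal hb
  have htb := engel_le_of_maximal hb hy hyb
  obtain ⟨S, hS, n, hn, rfl⟩ := Submodule.mem_sup.1
    (le_engel_sup_killingPerp_of_maximal hb hyb hHb)
  have : IsSolvable b := hb.1
  have : (engel ℂ y).IsCartanSubalgebra := isCartanSubalgebra_engel_of_isRegular hy
  rw [isRegular_congr_charpoly (charpoly_ad_add_of_isNilpotent_of_isSolvable b (htb hS) (hcb hn)
    (isNilpotent_ad_of_mem_killingPerp hb hn))]
  have hSx : ∀ x ∈ b, killingForm ℂ g S x = - LinearMap.trace ℂ g (E * ad ℂ g x) := by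
    intro x hx
    rw [← hH x hx, map_add, LinearMap.add_apply, mem_killingPerp.1 hn x hx, add_zero]
  suffices hle : engel ℂ S ≤ engel ℂ y by
    rw [isRegular_iff_finrank_engel_eq_rank] at hy ⊢
    refine le_antisymm ?_ (rank_le_finrank_engel ℂ S)
    rw [← hy]
    exact Submodule.finrank_mono (s := (engel ℂ S).toSubmodule) (t := (engel ℂ y).toSubmodule) hle
  refine engel_le_of_forall_weight_ne_zero (⟨S, hS⟩ : engel ℂ y) fun α hα hα0 => ?_
  obtain ⟨h, e, f, T, he, hf⟩ := IsKilling.exists_isSl2Triple_of_weight_isNonZero hα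
  have hh : h ∈ engel ℂ y := by
    rw [T.h_eq_coroot hα he hf]
    exact (IsKilling.coroot α).2
  have hef : killingForm ℂ g e f ≠ 0 := by
    intro h0
    have := IsKilling.lie_eq_killingForm_smul_of_mem_rootSpace_of_mem_rootSpace_neg he hf
    rw [h0, zero_smul, T.lie_e_f] at this
    exact T.h_ne_zero this
  have hα' : (α : engel ℂ y → ℂ) ≠ 0 := hα
  have he' := isNilpotent_ad_of_mem_rootSpace (engel ℂ y) hα' he
  have hf' := isNilpotent_ad_of_mem_rootSpace (engel ℂ y) (neg_ne_zero.2 hα') hf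
  have hs := IsKilling.isSemisimple_ad_of_mem_isCartanSubalgebra hh
  have hSe : ⁅S, e⁆ = 0 := by
    have : ⁅S, e⁆ = α ⟨S, hS⟩ • e := IsKilling.lie_eq_smul_of_mem_rootSpace he ⟨S, hS⟩
    rw [this, hα0, zero_smul]
  have htr : LinearMap.trace ℂ g (E * ad ℂ g h) = 0 := by
    rw [← neg_eq_zero, ← hSx h (htb hh), ← T.lie_e_f, ← killingForm_lie_left, hSe, map_zero,
      LinearMap.zero_apply]
  rcases mem_or_mem_killingPerp_of_isSl2Triple hb htb hα T he hf (htb hh) with hc | hc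
  · exact trace_mul_ad_ne_zero_of_isSl2Triple hb hE1 hE2 T hs he' hf' (htb hh) hc hef htr
  · refine trace_mul_ad_ne_zero_of_isSl2Triple hb hE1 hE2 T.symm ?_ hf' he' (neg_mem (htb hh)) hc
      (by rwa [killingForm_comm]) (by rw [map_neg, mul_neg, map_neg, htr, neg_zero])
    rw [map_neg, End.isSemisimple_neg]
    exact hs

end BorelTrace

section Centroid

open LieAlgebra Module

variable {g : Type*} [LieRing g] [LieAlgebra ℂ g] [FiniteDimensional ℂ g] [IsKilling ℂ g]

lemma apply_eq_zero_of_apply_apply_eq_zero {D : End ℂ g}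
    (hD : ∀ x y : g, D ⁅x, y⁆ = ⁅x, D y⁆) {v : g} (hv : D (D v) = 0) : D v = 0 := by
  have hD' : ∀ x y : g, ⁅D x, y⁆ = D ⁅x, y⁆ := fun x y => by
    rw [← lie_skew, ← hD, ← lie_skew x y, map_neg]
  refine eq_zero_of_killingForm fun y => ?_
  have hnil : IsNilpotent (ad ℂ g (D v) * ad ℂ g y) := by
    refine ⟨2, LinearMap.ext fun z => ?_⟩
    simp only [pow_two, End.mul_apply, ad_apply, LinearMap.zero_apply]
    rw [hD' v ⁅y, z⁆, ← hD y, hD' v, ← hD v, ← hD' v, ← hD' (D v), hv, zero_lie]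
  rw [killingForm_apply_apply]
  exact (LinearMap.isNilpotent_trace_of_isNilpotent hnil).eq_zero

lemma maxGenEigenspace_le_eigenspace {ψ : End ℂ g} (hψ : ∀ x y : g, ψ ⁅x, y⁆ = ⁅x, ψ y⁆) (c : ℂ) :
    ψ.maxGenEigenspace c ≤ ψ.eigenspace c := by
  intro v hv
  rw [End.mem_maxGenEigenspace] at hv
  obtain ⟨n, hn⟩ := hv
  have hD : ∀ x y : g, (ψ - c • 1) ⁅x, y⁆ = ⁅x, (ψ - c • 1) y⁆ := fun x y => by
    simp [hψ]
  have key : (ψ - c • 1) v = 0 := by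
    induction n with
    | zero =>
      have : v = 0 := by simpa using hn
      rw [this, map_zero]
    | succ n ih =>
      cases n with
      | zero => simpa using hn
      | succ n =>
        refine ih ?_
        rw [pow_succ', End.mul_apply] at hn ⊢
        rw [pow_succ', End.mul_apply] at hn
        exact apply_eq_zero_of_apply_apply_eq_zero hD hn
  rw [End.mem_eigenspace_iff]
  simpa [sub_eq_zero] using key

lemma eigenvector_induction {ψ : End ℂ g} (hψ : ∀ x y : g, ψ ⁅x, y⁆ = ⁅x, ψ y⁆) {p : g → Prop}
    (h0 : p 0) (hadd : ∀ x y, p x → p y → p (x + y))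
    (h : ∀ (c : ℂ) v, v ≠ 0 → ψ v = c • v → p v) (x : g) : p x := by
  have hx : x ∈ ⨆ c, ψ.maxGenEigenspace c := by
    rw [End.iSup_maxGenEigenspace_eq_top]
    trivial
  induction hx using Submodule.iSup_induction' with
  | mem c v hv =>
    by_cases hv0 : v = 0
    · rwa [hv0]
    · exact h c v hv0 (End.mem_eigenspace_iff.1 (maxGenEigenspace_le_eigenspace hψ c hv))
  | zero => exact h0
  | add x y _ _ hx hy => exact hadd x y hx hy

lemma exists_centroid_projections {ψ : End ℂ g} (hψ : ∀ x y : g, ψ ⁅x, y⁆ = ⁅x, ψ y⁆)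
    (hinj : ∀ x, ψ x = 0 → x = 0) :
    ∃ (S : Finset ℂ) (P : ℂ → End ℂ g), (∀ c ∈ S, c ≠ 0) ∧ (∀ x, ∑ c ∈ S, P c x = x) ∧
      (∀ c ∈ S, ∀ x, ψ (P c x) = c • P c x) ∧ (∀ c ∈ S, ∀ x, P c (P c x) = P c x) ∧
      (∀ c ∈ S, ∀ d ∈ S, c ≠ d → ∀ x, P c (P d x) = 0) ∧
      ∀ c ∈ S, ∀ x y : g, P c ⁅x, y⁆ = ⁅x, P c y⁆ := by
  let S : Finset ℂ := ψ.charpoly.roots.toFinset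
  let P : ℂ → End ℂ g := fun c => Polynomial.aeval ψ (Lagrange.basis S id c)
  have hS : ∀ (c : ℂ) v, v ≠ 0 → ψ v = c • v → c ∈ S := by
    intro c v hv hc
    rw [Multiset.mem_toFinset, Polynomial.mem_roots ψ.charpoly_monic.ne_zero,
      ← End.hasEigenvalue_iff_isRoot_charpoly]
    exact End.hasEigenvalue_of_hasEigenvector ⟨End.mem_eigenspace_iff.2 hc, hv⟩
  have hP : ∀ (d c : ℂ) v, v ≠ 0 → ψ v = c • v → P d v = (Lagrange.basis S id d).eval c • v :=
    fun d c v hv hc => End.aeval_apply_of_hasEigenvector ⟨End.mem_eigenspace_iff.2 hc, hv⟩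
  have hP1 : ∀ c ∈ S, ∀ v, ψ v = c • v → P c v = v := by
    intro c hcS v hc
    by_cases hv : v = 0
    · rw [hv, map_zero]
    · rw [hP c c v hv hc]
      have := Lagrange.eval_basis_self (v := (id : ℂ → ℂ)) Function.injective_id.injOn hcS
      rw [id] at this
      rw [this, one_smul]
  have hP0 : ∀ d c : ℂ, d ≠ c → ∀ v, ψ v = c • v → P d v = 0 := by
    intro d c hdc v hc
    by_cases hv : v = 0
    · rw [hv, map_zero]
    · rw [hP d c v hv hc]
      have := Lagrange.eval_basis_of_ne (v := (id : ℂ → ℂ)) hdc (hS c v hv hc)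
      rw [id] at this
      rw [this, zero_smul]
  have hψP : ∀ c ∈ S, ∀ x, ψ (P c x) = c • P c x := by
    intro c hcS x
    induction x using eigenvector_induction hψ with
    | h0 => simp
    | hadd x y hx hy => rw [map_add, map_add, hx, hy, smul_add]
    | h d v hv hd =>
      by_cases hcd : c = d
      · subst hcd
        rw [hP1 c hcS v hd, hd]
      · rw [hP0 c d hcd v hd, map_zero, smul_zero]
  refine ⟨S, P, ?_, ?_, hψP, fun c hcS x => hP1 c hcS _ (hψP c hcS x),
    fun c hcS d hdS hcd x => hP0 c d hcd _ (hψP d hdS x), ?_⟩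
  · rintro c hcS rfl
    rw [Multiset.mem_toFinset, Polynomial.mem_roots ψ.charpoly_monic.ne_zero,
      ← End.hasEigenvalue_iff_isRoot_charpoly] at hcS
    obtain ⟨v, hv⟩ := hcS.exists_hasEigenvector
    exact hv.2 (hinj v (by rw [hv.apply_eq_smul, zero_smul]))
  · intro x
    induction x using eigenvector_induction hψ with
    | h0 => simp
    | hadd x y hx hy => simp only [map_add, Finset.sum_add_distrib, hx, hy]
    | h d v hv hd =>
      rw [Finset.sum_eq_single d (fun c _ hcd => hP0 c d hcd v hd) fun h => (h (hS d v hv hd)).elim]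
      exact hP1 d (hS d v hv hd) v hd
  · intro c hcS x y
    induction y using eigenvector_induction hψ with
    | h0 => simp
    | hadd y z hy hz => rw [lie_add, map_add, map_add, hy, hz, lie_add]
    | h d v hv hd =>
      have hd' : ψ ⁅x, v⁆ = d • ⁅x, v⁆ := by rw [hψ, hd, lie_smul]
      by_cases hcd : c = d
      · subst hcd
        rw [hP1 c hcS _ hd, hP1 c hcS _ hd']
      · rw [hP0 c d hcd _ hd, hP0 c d hcd _ hd', lie_zero]

end Centroid

section YangBaxter

open LieAlgebra LieSubalgebra Module

variable {g : Type*} [LieRing g] [LieAlgebra ℂ g] [FiniteDimensional ℂ g]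

lemma isRegular_apply_of_centroid {ψ : End ℂ g} (hψ : ∀ x y : g, ψ ⁅x, y⁆ = ⁅x, ψ y⁆)
    (hinj : ∀ x, ψ x = 0 → x = 0) {H : g} (hH : IsRegular ℂ H) : IsRegular ℂ (ψ H) := by
  have hcomm : Commute ψ (ad ℂ g H) := LinearMap.ext fun y => hψ H y
  have had : ad ℂ g (ψ H) = ψ * ad ℂ g H := by
    ext y
    rw [End.mul_apply, ad_apply, ad_apply, ← lie_skew, ← hψ, ← map_neg, lie_skew]
  have hpow : ∀ (n : ℕ) y, (ψ ^ n) y = 0 → y = 0 := by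
    intro n
    induction n with
    | zero => intro y hy; simpa using hy
    | succ n ih => intro y hy; exact hinj y (ih _ (by rwa [pow_succ, End.mul_apply] at hy))
  have : engel ℂ (ψ H) = engel ℂ H := by
    ext y
    simp only [mem_engel_iff, had, hcomm.mul_pow, End.mul_apply]
    exact exists_congr fun n => ⟨hpow n _, fun h => by rw [h, map_zero]⟩
  rwa [isRegular_iff_finrank_engel_eq_rank, this, ← isRegular_iff_finrank_engel_eq_rank]

variable [IsKilling ℂ g]

lemma IsRotaBaxter.isRegular {f : End ℂ g} (hf : IsRotaBaxter f)
    (hK : ∀ x y, killingForm ℂ g (f x) y + killingForm ℂ g x (f y) = killingForm ℂ g x y) {H : g}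
    (hH : ∀ x, killingForm ℂ g H x = LinearMap.trace ℂ g (ad ℂ g x * f)) : IsRegular ℂ H := by
  obtain ⟨b, hb, hbE⟩ := hf.exists_maximal_isSolvable hK
  obtain ⟨F, hF⟩ := (LinearMap.id : killingPerp b.toSubmodule →ₗ[ℂ] _).exists_extend
  let E : End ℂ g := (killingPerp b.toSubmodule).subtype ∘ₗ F
  have h1 : ∀ v, E v ∈ killingPerp b.toSubmodule := fun v => (F v).2
  have h2 : ∀ v ∈ killingPerp b.toSubmodule, E v = v := fun v hv =>
    congrArg Subtype.val (LinearMap.congr_fun hF ⟨v, hv⟩)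
  exact isRegular_of_killingForm_eq_neg_trace hb h1 h2 fun x hx => by rw [hH, hbE E h1 h2 x hx]

lemma isRegular_of_yangBaxter {ρ ρ' ψ : End ℂ g}
    (hadj : ∀ x y, killingForm ℂ g (ρ x) y = killingForm ℂ g x (ρ' y)) (hadd : ρ + ρ' = ψ)
    (hψ : ∀ x y : g, ψ ⁅x, y⁆ = ⁅x, ψ y⁆) (hinj : ∀ x, ψ x = 0 → x = 0)
    (hYB : ∀ x y, ⁅ρ x, ρ y⁆ = ρ (⁅ρ x, y⁆ + ⁅x, ρ y⁆ - ⁅x, ψ y⁆)) {H : g}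
    (hH : ∀ x, killingForm ℂ g H x = - LinearMap.trace ℂ g (ad ℂ g x * ρ)) : IsRegular ℂ H := by
  obtain ⟨S, P, hS, hsum, hψP, hPP, hPQ, hP⟩ := exists_centroid_projections hψ hinj
  have hP' : ∀ c ∈ S, ∀ x y : g, P c ⁅x, y⁆ = ⁅P c x, y⁆ := fun c hc x y => by
    rw [← lie_skew, map_neg, hP c hc, lie_skew]
  have hψK : ∀ x y, killingForm ℂ g (ψ x) y = killingForm ℂ g x (ψ y) := fun x y => by
    rw [← hadd, LinearMap.add_apply, LinearMap.add_apply, map_add, map_add, LinearMap.add_apply,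
      hadj, killingForm_comm (ρ' x), ← hadj y x, killingForm_comm (ρ y), add_comm]
  have hPK0 : ∀ c ∈ S, ∀ d ∈ S, c ≠ d → ∀ x y, killingForm ℂ g (P c x) (P d y) = 0 := by
    intro c hc d hd hcd x y
    have := hψK (P c x) (P d y)
    rw [hψP c hc, hψP d hd, map_smul, map_smul, LinearMap.smul_apply, smul_eq_mul, smul_eq_mul,
      ← sub_eq_zero, ← sub_mul] at this
    exact (mul_eq_zero.1 this).resolve_left (sub_ne_zero.2 hcd)
  have hPK : ∀ c ∈ S, ∀ x y, killingForm ℂ g (P c x) y = killingForm ℂ g x (P c y) := by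
    intro c hc x y
    have e1 : killingForm ℂ g (P c x) y = killingForm ℂ g (P c x) (P c y) := by
      conv_lhs => rw [← hsum y, map_sum]
      exact Finset.sum_eq_single c (fun d hd hdc => hPK0 c hc d hd hdc.symm x y)
        fun h => (h hc).elim
    have e2 : killingForm ℂ g x (P c y) = killingForm ℂ g (P c x) (P c y) := by
      conv_lhs => rw [← hsum x, map_sum, LinearMap.sum_apply]
      exact Finset.sum_eq_single c (fun d hd hdc => hPK0 d hd c hc hdc x y) fun h => (h hc).elim
    rw [e1, e2]
  let f : End ℂ g := ∑ c ∈ S, c⁻¹ • (P c * ρ * P c)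
  let χ : End ℂ g := ∑ c ∈ S, c⁻¹ • P c
  have hf : ∀ x, f x = ∑ c ∈ S, c⁻¹ • P c (ρ (P c x)) := fun x => by
    simp [f, LinearMap.sum_apply]
  have hχ : ∀ x, χ x = ∑ c ∈ S, c⁻¹ • P c x := fun x => by simp [χ, LinearMap.sum_apply]
  have hPf : ∀ c ∈ S, ∀ x, P c (f x) = c⁻¹ • P c (ρ (P c x)) := by
    intro c hc x
    rw [hf, map_sum, Finset.sum_eq_single c]
    · rw [map_smul, hPP c hc]
    · intro d hd hdc
      rw [map_smul, hPQ c hc d hd hdc.symm, smul_zero]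
    · exact fun h => (h hc).elim
  have hρ : ∀ c ∈ S, ∀ x, P c (ρ (P c x)) = c • P c (f x) := fun c hc x => by
    rw [hPf c hc, smul_smul, mul_inv_cancel₀ (hS c hc), one_smul]
  have hRB : IsRotaBaxter f := by
    intro x y
    refine (hsum _).symm.trans ((Finset.sum_congr rfl fun c hc => ?_).trans (hsum _))
    have hl : ⁅ρ (P c x), P c y⁆ = c • P c ⁅f x, y⁆ := by
      rw [← hP c hc, hP' c hc, hρ c hc, smul_lie, ← hP' c hc]
    have hr : ⁅P c x, ρ (P c y)⁆ = c • P c ⁅x, f y⁆ := by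
      rw [← hP' c hc, hP c hc, hρ c hc, lie_smul, ← hP c hc]
    have hlr : ⁅P c x, ψ (P c y)⁆ = c • P c ⁅x, y⁆ := by
      rw [hψP c hc, lie_smul, ← hP' c hc, ← hP c hc, hPP c hc]
    calc P c ⁅f x, f y⁆ = ⁅P c (f x), P c (f y)⁆ := by
          rw [← hP' c hc, ← hP c hc, hPP c hc]
      _ = (c⁻¹ * c⁻¹) • P c ⁅ρ (P c x), ρ (P c y)⁆ := by
          rw [hPf c hc, hPf c hc, smul_lie, lie_smul, smul_smul, ← hP' c hc, ← hP c hc, hPP c hc]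
      _ = c⁻¹ • P c (ρ (P c (⁅f x, y⁆ + ⁅x, f y⁆ - ⁅x, y⁆))) := by
          rw [hYB, hl, hr, hlr, ← smul_add, ← smul_sub, ← map_add, ← map_sub, map_smul, map_smul,
            smul_smul, mul_assoc, inv_mul_cancel₀ (hS c hc), mul_one]
      _ = P c (f (⁅f x, y⁆ + ⁅x, f y⁆ - ⁅x, y⁆)) := (hPf c hc _).symm
  have hfK : ∀ x y, killingForm ℂ g (f x) y + killingForm ℂ g x (f y) = killingForm ℂ g x y := by
    intro x y
    rw [hf, hf, map_sum, map_sum, LinearMap.sum_apply, ← Finset.sum_add_distrib]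
    conv_rhs => rw [← hsum y, map_sum]
    refine Finset.sum_congr rfl fun c hc => ?_
    have e1 : killingForm ℂ g (ρ (P c x)) (P c y) + killingForm ℂ g (P c x) (ρ (P c y)) =
        c * killingForm ℂ g x (P c y) := by
      rw [hadj, add_comm, ← map_add, ← LinearMap.add_apply, hadd, hψP c hc, map_smul, smul_eq_mul,
        hPK c hc, hPP c hc]
    rw [map_smul, map_smul, LinearMap.smul_apply, hPK c hc, ← hPK c hc x, ← smul_add, e1,
      smul_eq_mul, inv_mul_cancel_left₀ (hS c hc)]
  have hχK : ∀ x y, killingForm ℂ g (χ x) y = killingForm ℂ g x (χ y) := by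
    intro x y
    rw [hχ, hχ, map_sum, map_sum, LinearMap.sum_apply]
    refine Finset.sum_congr rfl fun c hc => ?_
    rw [map_smul, map_smul, LinearMap.smul_apply, hPK c hc]
  have hψχ : ∀ x, ψ (χ x) = x := by
    intro x
    rw [hχ, map_sum]
    conv_rhs => rw [← hsum x]
    refine Finset.sum_congr rfl fun c hc => ?_
    rw [map_smul, hψP c hc, smul_smul, inv_mul_cancel₀ (hS c hc), one_smul]
  have htr : ∀ x, LinearMap.trace ℂ g (ad ℂ g (χ x) * ρ) = LinearMap.trace ℂ g (ad ℂ g x * f) := by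
    intro x
    rw [hχ, map_sum, Finset.sum_mul, map_sum, Finset.mul_sum, map_sum]
    refine Finset.sum_congr rfl fun c hc => ?_
    have had : ad ℂ g (P c x) = P c * (ad ℂ g x * P c) := by
      ext y
      rw [ad_apply, End.mul_apply, End.mul_apply, ad_apply, ← hP c hc, hPP c hc, hP' c hc]
    rw [map_smul, smul_mul_assoc, mul_smul_comm, map_smul, map_smul, had, mul_assoc (P c),
      LinearMap.trace_mul_comm, mul_assoc, mul_assoc, mul_assoc]
  have hreg : IsRegular ℂ (-χ H) := by
    refine hRB.isRegular hfK fun x => ?_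
    rw [map_neg, LinearMap.neg_apply, hχK, hH, htr, neg_neg]
  have := isRegular_apply_of_centroid (ψ := -ψ) (fun x y => by simp [hψ])
    (fun x hx => hinj x (by simpa using hx)) hreg
  simpa [hψχ] using this

end YangBaxter

section RMatrix

open LieAlgebra Module

variable {g : Type*} [LieRing g] [LieAlgebra ℂ g]

/-- Contraction of the first tensor factor with `x` through the Killing form. -/
noncomputable def killingContract (x : g) : g ⊗[ℂ] g →ₗ[ℂ] g :=
  (TensorProduct.lid ℂ g).toLinearMap ∘ₗ TensorProduct.map (killingForm ℂ g x) LinearMap.id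

lemma killingContract_tmul (x a b : g) :
    killingContract x (a ⊗ₜ[ℂ] b) = killingForm ℂ g x a • b := by
  simp [killingContract]

lemma killingContract_lie (x z : g) (u : g ⊗[ℂ] g) :
    killingContract x ⁅z, u⁆ = killingContract ⁅x, z⁆ u + ⁅z, killingContract x u⁆ := by
  induction u with
  | zero => simp
  | tmul a b => simp [killingContract_tmul, TensorProduct.LieModule.lie_tmul_right,
      killingForm_lie_left]
  | add u v hu hv => rw [lie_add, map_add, hu, hv, map_add, map_add, lie_add]; abel

/-- The endomorphism of `g` corresponding to `∑ i, a i ⊗ b i` under the Killing form. -/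
noncomputable def killingEnd {n : ℕ} (a b : Fin n → g) : End ℂ g :=
  ∑ i, (killingForm ℂ g (a i)).smulRight (b i)

lemma killingEnd_apply {n : ℕ} (a b : Fin n → g) (x : g) :
    killingEnd a b x = ∑ i, killingForm ℂ g x (a i) • b i := by
  simp [killingEnd, killingForm_comm x]

lemma killingContract_eq_killingEnd {n : ℕ} (a b : Fin n → g) (x : g) :
    killingContract x (∑ i, a i ⊗ₜ[ℂ] b i) = killingEnd a b x := by
  simp [killingEnd_apply, killingContract_tmul]

lemma killingForm_killingEnd {n : ℕ} (a b : Fin n → g) (x y : g) :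
    killingForm ℂ g (killingEnd a b x) y = killingForm ℂ g x (killingEnd b a y) := by
  simp only [killingEnd_apply, map_sum, map_smul, LinearMap.sum_apply, LinearMap.smul_apply,
    smul_eq_mul]
  exact Finset.sum_congr rfl fun i _ => by rw [killingForm_comm y (b i), mul_comm]

lemma killingEnd_yangBaxter {n : ℕ} {a b : Fin n → g}
    (h : ∑ i, ∑ j, ((⁅a i, a j⁆ ⊗ₜ[ℂ] (b i ⊗ₜ[ℂ] b j)) + (a i ⊗ₜ[ℂ] (⁅b i, a j⁆ ⊗ₜ[ℂ] b j))
      + (a i ⊗ₜ[ℂ] (a j ⊗ₜ[ℂ] ⁅b i, b j⁆))) = (0 : g ⊗[ℂ] (g ⊗[ℂ] g))) (x y : g) :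
    killingEnd a b ⁅x, killingEnd b a y⁆ + killingEnd a b ⁅y, killingEnd a b x⁆
      + ⁅killingEnd a b x, killingEnd a b y⁆ = 0 := by
  have h' := congrArg (killingContract y ∘ₗ (TensorProduct.lid ℂ (g ⊗[ℂ] g)).toLinearMap ∘ₗ
    TensorProduct.map (killingForm ℂ g x) LinearMap.id) h
  simp only [map_sum, map_add, map_zero, LinearMap.comp_apply, TensorProduct.map_tmul,
    LinearEquiv.coe_coe, TensorProduct.lid_tmul, LinearMap.id_apply, map_smul,
    killingContract_tmul, Finset.sum_add_distrib] at h'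
  rw [← h']
  congr 1
  · congr 1
    · rw [killingEnd_apply, Finset.sum_comm]
      refine Finset.sum_congr rfl fun j _ => ?_
      rw [killingForm_lie_left, killingEnd_apply, sum_lie]
      simp [Finset.sum_smul, smul_smul, mul_comm]
    · rw [killingEnd_apply, Finset.sum_comm]
      refine Finset.sum_congr rfl fun j _ => ?_
      rw [killingForm_lie_left, killingEnd_apply, sum_lie]
      simp [Finset.sum_smul, smul_smul]
  · rw [killingEnd_apply, killingEnd_apply]
    simp only [sum_lie, lie_sum, smul_lie, lie_smul, Finset.smul_sum]
    rw [Finset.sum_comm]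
    exact Finset.sum_congr rfl fun i _ => Finset.sum_congr rfl fun j _ => smul_comm _ _ _

lemma killingForm_sum_lie [FiniteDimensional ℂ g] {n : ℕ} (a b : Fin n → g) (x : g) :
    killingForm ℂ g (∑ i, ⁅a i, b i⁆) x = - LinearMap.trace ℂ g (ad ℂ g x * killingEnd a b) := by
  have h : ad ℂ g x * killingEnd a b = ∑ i, (killingForm ℂ g (a i)).smulRight ⁅x, b i⁆ := by
    ext y
    simp [killingEnd]
  rw [h, map_sum, map_sum, LinearMap.sum_apply, ← Finset.sum_neg_distrib]
  refine Finset.sum_congr rfl fun i _ => ?_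
  rw [LinearMap.trace_smulRight, killingForm_lie_left, ← lie_skew, map_neg]

end RMatrix

/-- for a factorizable complex semisimple Lie bialgebra with r-matrix r,
H_r = β(r) is regular and its centralizer is a Cartan subalgebra. -/
theorem factorizable_Hr_regular_and_centralizer_cartan
    {g : Type*} [LieRing g] [LieAlgebra ℂ g] [FiniteDimensional ℂ g]
    [LieAlgebra.IsSemisimple ℂ g]
    (r : g ⊗[ℂ] g) (hfact : IsFactorizableRMatrix r) :
    LieAlgebra.IsRegular ℂ (bracketMap ℂ g r) ∧
    (centralizerOf ℂ g (bracketMap ℂ g r)).IsCartanSubalgebra := by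
  obtain ⟨⟨n, a, b, rfl, hYB⟩, hinv, hbij⟩ := hfact
  set r : g ⊗[ℂ] g := ∑ i, a i ⊗ₜ[ℂ] b i with hr
  have hs (x : g) : killingContract x (symPart r) = (killingEnd a b + killingEnd b a) x := by
    simp only [symPart, map_add, hr, map_sum, TensorProduct.comm_tmul, LinearMap.add_apply,
      ← killingContract_eq_killingEnd]
  have hψ (x y : g) : (killingEnd a b + killingEnd b a) ⁅x, y⁆
      = ⁅x, (killingEnd a b + killingEnd b a) y⁆ := by
    have h := killingContract_lie y x (symPart r)
    rw [hinv, map_zero, hs, hs, ← lie_skew, map_neg, neg_add_eq_sub, eq_comm, sub_eq_zero] at h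
    exact h.symm
  have hreg : LieAlgebra.IsRegular ℂ (bracketMap ℂ g r) := by
    refine isRegular_of_yangBaxter (killingForm_killingEnd a b) rfl hψ (fun x hx => ?_)
      (fun x y => ?_) (fun x => ?_)
    · refine eq_zero_of_killingForm fun y => ?_
      have h : killingForm ℂ g x = 0 := by
        apply hbij.1
        have h2 := hs x
        rw [hx] at h2
        simpa [killingContract] using h2
      rw [h, LinearMap.zero_apply]
    · have h := killingEnd_yangBaxter hYB x y
      rw [← lie_skew y, map_neg] at h
      rw [LinearMap.add_apply, lie_add, map_sub, map_add, map_add, ← sub_eq_zero, ← h]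
      abel
    · rw [← killingForm_sum_lie]
      simp [hr, bracketMap, bracketBilin]
  refine ⟨hreg, ?_⟩
  rw [centralizerOf_eq_engel_of_isRegular hreg]
  exact isCartanSubalgebra_engel_of_isRegular hreg
end
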